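/- arXiv:2511.10584 — 2 statements merged into one kernel-verified Lean document; each statement's English description precedes it below -/
import Mathlib

section
/- Let W_G ∈ ℂ^{m×k} and W_Z ∈ ℂ^{m×n} be isometries (W_G†W_G = I_k, W_Z†W_Z = I_n) such that the column range of W_G is contained in the column range of W_Z, and set S := W_Z† W_G. Let A be a k×k Hermitian positive semidefinite matrix, B an n×n Hermitian positive definite matrix, and α ∈ (1/2, 1). Then Tr[((W_Z B W_Z†)^{(1−α)/(2α)} (W_G A W_G†) (W_Z B W_Z†)^{(1−α)/(2α)})^α] = Tr[(A^{1/2} S† B^{(1−α)/α} S A^{1/2})^α]. -/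
open Matrix
open scoped ComplexOrder

/-- The real power of a matrix, taken via the continuous functional calculus applied to
`x ↦ x ^ p` (real `rpow`, so that `0 ^ p = 0` for `p ≠ 0`). -/
noncomputable def mpow {n : ℕ} (A : Matrix (Fin n) (Fin n) ℂ) (p : ℝ) :
    Matrix (Fin n) (Fin n) ℂ :=
  cfc (fun x : ℝ => x ^ p) A

open Polynomial in
/-- On a finite set, a function vanishing at `0` agrees with a polynomial divisible by `X`. -/
lemma exists_X_mul_eval_eq {K : Type*} [Field K] (s : Set K) (hs : s.Finite) (f : K → K)
    (hf : f 0 = 0) : ∃ q : K[X], ∀ x ∈ s, (X * q).eval x = f x := by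
  classical
  let t : Finset K := insert 0 hs.toFinset
  have heval : ∀ x ∈ t, (Lagrange.interpolate t id f).eval x = f x := fun x hx =>
    Lagrange.eval_interpolate_at_node f (Function.injective_id.injOn) hx
  have hdvd : X ∣ Lagrange.interpolate t id f := by
    rw [X_dvd_iff, coeff_zero_eq_eval_zero, heval 0 (by simp [t]), hf]
  obtain ⟨q, hq⟩ := hdvd
  exact ⟨q, fun x hx => by rw [← hq]; exact heval x (by simp [t, hx])⟩

namespace Matrix

open Polynomial in
lemma aeval_mul_mul_comm {R S m n : Type*} [CommSemiring R] [Semiring S] [Algebra R S]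
    [Fintype m] [Fintype n] [DecidableEq m] [DecidableEq n]
    (Y : Matrix m n S) (Z : Matrix n m S) (q : R[X]) :
    aeval (Y * Z) q * Y = Y * aeval (Z * Y) q := by
  induction q using Polynomial.induction_on' with
  | add p q hp hq => simp [Matrix.add_mul, Matrix.mul_add, hp, hq]
  | monomial k r =>
    have h : (Y * Z) ^ k * Y = Y * (Z * Y) ^ k := by
      induction k with
      | zero => simp
      | succ k ih => rw [pow_succ, pow_succ', Matrix.mul_assoc, Matrix.mul_assoc Y Z Y,
          ← Matrix.mul_assoc, ih, Matrix.mul_assoc, ← pow_succ, ← pow_succ']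
    simp [aeval_monomial, Algebra.algebraMap_eq_smul_one, h]

variable {m n : Type*} [Fintype m] [Fintype n] [DecidableEq m] [DecidableEq n]

open Polynomial in
/-- The functional calculi of `Y * Z` and `Z * Y`, for a function vanishing at `0`, are given by
a common polynomial without constant term. -/
lemma exists_cfc_mul_eq (Y : Matrix m n ℂ) (Z : Matrix n m ℂ) (hYZ : IsSelfAdjoint (Y * Z))
    (hZY : IsSelfAdjoint (Z * Y)) (f : ℝ → ℝ) (hf : f 0 = 0) :
    ∃ C : Matrix n n ℂ, cfc f (Y * Z) = Y * C * Z ∧ cfc f (Z * Y) = C * (Z * Y) := by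
  obtain ⟨q, hq⟩ := exists_X_mul_eval_eq (spectrum ℝ (Y * Z) ∪ spectrum ℝ (Z * Y))
    (finite_real_spectrum.union finite_real_spectrum) f hf
  refine ⟨aeval (Z * Y) q, ?_, ?_⟩
  · rw [← cfc_congr (fun x hx => hq x (Or.inl hx)), cfc_polynomial _ _ hYZ, mul_comm X q, map_mul,
      aeval_X, ← Matrix.mul_assoc, aeval_mul_mul_comm]
  · rw [← cfc_congr (fun x hx => hq x (Or.inr hx)), cfc_polynomial _ _ hZY, mul_comm X q, map_mul,
      aeval_X]

lemma trace_cfc_mul_comm (Y : Matrix m n ℂ) (Z : Matrix n m ℂ) (hYZ : IsSelfAdjoint (Y * Z))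
    (hZY : IsSelfAdjoint (Z * Y)) (f : ℝ → ℝ) (hf : f 0 = 0) :
    (cfc f (Y * Z)).trace = (cfc f (Z * Y)).trace := by
  obtain ⟨C, h₁, h₂⟩ := exists_cfc_mul_eq Y Z hYZ hZY f hf
  rw [h₁, h₂, Matrix.mul_assoc, trace_mul_comm, Matrix.mul_assoc]

lemma cfc_isometry_conj (W : Matrix m n ℂ) (hW : Wᴴ * W = 1) (B : Matrix n n ℂ)
    (hB : B.IsHermitian) (f : ℝ → ℝ) (hf : f 0 = 0) :
    cfc f (W * B * Wᴴ) = W * cfc f B * Wᴴ := by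
  have hBW : B * Wᴴ * W = B := by rw [Matrix.mul_assoc, hW, Matrix.mul_one]
  obtain ⟨C, h₁, h₂⟩ := exists_cfc_mul_eq W (B * Wᴴ)
    (by rw [← Matrix.mul_assoc]; exact isHermitian_mul_mul_conjTranspose W hB)
    (by rw [hBW]; exact hB) f hf
  rw [hBW] at h₂
  rw [Matrix.mul_assoc, h₁, h₂]
  simp only [Matrix.mul_assoc]

end Matrix

lemma isHermitian_mpow {n : ℕ} (A : Matrix (Fin n) (Fin n) ℂ) (p : ℝ) :
    (mpow A p).IsHermitian :=
  cfc_predicate (R := ℝ) (p := IsSelfAdjoint) _ A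

lemma mpow_mul_mpow {n : ℕ} {A : Matrix (Fin n) (Fin n) ℂ} (hA : A.PosSemidef) {p q : ℝ}
    (hp : 0 ≤ p) (hq : 0 ≤ q) : mpow A p * mpow A q = mpow A (p + q) := by
  have hfin : (spectrum ℝ A).Finite := Matrix.finite_real_spectrum
  unfold mpow
  rw [← cfc_mul _ _ A (hfin.continuousOn _) (hfin.continuousOn _)]
  refine cfc_congr fun x hx => ?_
  have hx₀ : 0 ≤ x := Complex.zero_le_real.mp
    ((Matrix.posSemidef_iff_isHermitian_and_spectrum_nonneg.mp hA).2 hx)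
  exact (Real.rpow_add_of_nonneg hx₀ hp hq).symm

lemma mpow_one {n : ℕ} {A : Matrix (Fin n) (Fin n) ℂ} (hA : A.IsHermitian) : mpow A 1 = A := by
  simp only [mpow, Real.rpow_one]
  exact cfc_id' ℝ A hA

/-- Facial reduction identity for the sandwiched Rényi trace functional: if `W_G`, `W_Z` are
isometries with `range W_G ⊆ range W_Z`, `S := W_Zᴴ W_G`, `A ⪰ 0`, `B ≻ 0` and
`α ∈ (1/2, 1)`, then
`Tr[((W_Z B W_Zᴴ)^{(1−α)/(2α)} (W_G A W_Gᴴ) (W_Z B W_Zᴴ)^{(1−α)/(2α)})^α]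
  = Tr[(A^{1/2} Sᴴ B^{(1−α)/α} S A^{1/2})^α]`. -/
theorem stmt5 {m k n : ℕ}
    (WG : Matrix (Fin m) (Fin k) ℂ) (WZ : Matrix (Fin m) (Fin n) ℂ)
    (hWG : WGᴴ * WG = 1) (hWZ : WZᴴ * WZ = 1)
    (hrange : ∀ x : Fin k → ℂ, ∃ y : Fin n → ℂ, WG.mulVec x = WZ.mulVec y)
    (A : Matrix (Fin k) (Fin k) ℂ) (hA : A.PosSemidef)
    (B : Matrix (Fin n) (Fin n) ℂ) (hB : B.PosDef)
    (α : ℝ) (hα : α ∈ Set.Ioo (1 / 2 : ℝ) 1) :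
    (mpow (mpow (WZ * B * WZᴴ) ((1 - α) / (2 * α)) * (WG * A * WGᴴ)
        * mpow (WZ * B * WZᴴ) ((1 - α) / (2 * α))) α).trace
      = (mpow (mpow A (1 / 2) * (WZᴴ * WG)ᴴ * mpow B ((1 - α) / α) * (WZᴴ * WG)
        * mpow A (1 / 2)) α).trace := by
  obtain ⟨hα₁, hα₂⟩ := hα
  have hα₀ : 0 < α := by linarith
  have hs : 0 < (1 - α) / (2 * α) := div_pos (by linarith) (by linarith)
  have hsum : (1 - α) / (2 * α) + (1 - α) / (2 * α) = (1 - α) / α := by field_simp; norm_num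
  have hM := isHermitian_mpow (WZ * B * WZᴴ) ((1 - α) / (2 * α))
  have hMM : mpow (WZ * B * WZᴴ) ((1 - α) / (2 * α)) * mpow (WZ * B * WZᴴ) ((1 - α) / (2 * α))
      = WZ * mpow B ((1 - α) / α) * WZᴴ := by
    rw [mpow_mul_mpow (hB.posSemidef.mul_mul_conjTranspose_same WZ) hs.le hs.le, hsum]
    exact cfc_isometry_conj WZ hWZ B hB.isHermitian _
      (Real.zero_rpow (div_pos (by linarith) hα₀).ne')
  have hR := isHermitian_mpow A (1 / 2)
  have hRR : mpow A (1 / 2) * mpow A (1 / 2) = A := by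
    rw [mpow_mul_mpow hA (by norm_num) (by norm_num), add_halves, mpow_one hA.isHermitian]
  generalize mpow (WZ * B * WZᴴ) ((1 - α) / (2 * α)) = M at *
  generalize mpow A (1 / 2) = R at *
  generalize mpow B ((1 - α) / α) = D at *
  have hadj : (M * WG * R)ᴴ = R * WGᴴ * M := by
    simp only [conjTranspose_mul, hM.eq, hR.eq, Matrix.mul_assoc]
  have hleft : M * (WG * A * WGᴴ) * M = (M * WG * R) * (R * WGᴴ * M) := by
    rw [← hRR]
    simp only [Matrix.mul_assoc]
  have hright : R * (WZᴴ * WG)ᴴ * D * (WZᴴ * WG) * R = (R * WGᴴ * M) * (M * WG * R) := by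
    calc _ = R * WGᴴ * (WZ * D * WZᴴ) * WG * R := by
          simp only [conjTranspose_mul, conjTranspose_conjTranspose, Matrix.mul_assoc]
      _ = _ := by rw [← hMM]; simp only [Matrix.mul_assoc]
  rw [hleft, hright, ← hadj]
  exact trace_cfc_mul_comm _ _ (isHermitian_mul_conjTranspose_self _)
    (isHermitian_conjTranspose_mul_self _) _ (Real.zero_rpow hα₀.ne')
end

section
/- Let S be an n×k complex matrix with S†S = I_k, let α ∈ [1/2, 1), let G, H be k×k Hermitian matrices and Z, K be n×n Hermitian matrices such that G, G+H, G−H, Z, Z+K, Z−K are all positive definite. Then the function ψ : (−1,1) → ℝ defined by ψ(t) := Tr[((G+tH)^{1/2} S† (Z+tK)^{(1−α)/α} S (G+tH)^{1/2})^α] is operator-concave on (−1,1). -/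
open Matrix
open scoped ComplexOrder

/-- A continuous real function `φ` is operator-concave on an interval `J ⊆ ℝ` if for every
dimension `d`, all Hermitian `d × d` matrices `X, Y` whose eigenvalues (real spectrum) lie
in `J`, and every `λ ∈ [0,1]`,
`φ(λX + (1−λ)Y) ⪰ λ·φ(X) + (1−λ)·φ(Y)` in the Loewner order, where `φ` is applied to
Hermitian matrices via the continuous functional calculus. -/
def OperatorConcaveOn (φ : ℝ → ℝ) (J : Set ℝ) : Prop :=
  ∀ (d : ℕ) (X Y : Matrix (Fin d) (Fin d) ℂ),
    X.IsHermitian → Y.IsHermitian →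
    spectrum ℝ X ⊆ J → spectrum ℝ Y ⊆ J →
    ∀ l : ℝ, 0 ≤ l → l ≤ 1 →
      (cfc φ (l • X + (1 - l) • Y) - (l • cfc φ X + (1 - l) • cfc φ Y)).PosSemidef

section
open Set MeasureTheory Filter Topology
open scoped Matrix.Norms.L2Operator unitInterval

/-- An integral over the unit interval depending holomorphically on a parameter is holomorphic. -/
lemma differentiableOn_integral_unitInterval {E : Type*} [NormedAddCommGroup E] [NormedSpace ℂ E]
    (ν : Measure I) [IsFiniteMeasure ν] {U : Set ℂ} (hU : IsOpen U) {h : ℂ → I → E}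
    (hc : ContinuousOn (Function.uncurry h) (U ×ˢ univ))
    (hd : ∀ s, DifferentiableOn ℂ (fun z => h z s) U) :
    DifferentiableOn ℂ (fun z => ∫ s, h z s ∂ν) U := by
  intro z₀ hz₀
  obtain ⟨δ, hδ, hball⟩ : ∃ δ > 0, Metric.closedBall z₀ (2 * δ) ⊆ U := by
    obtain ⟨ε, hε, h'⟩ := Metric.isOpen_iff.mp hU z₀ hz₀
    exact ⟨ε / 4, by positivity, (Metric.closedBall_subset_ball (by linarith)).trans h'⟩
  have hcz : ∀ z ∈ U, Continuous (h z) := fun z hz => by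
    rw [← continuousOn_univ]
    exact hc.comp (f := fun s => (z, s)) (by fun_prop) (fun s _ => ⟨hz, mem_univ s⟩)
  obtain ⟨C, hC⟩ : ∃ C, ∀ p ∈ Metric.closedBall z₀ (2 * δ) ×ˢ (univ : Set I),
      ‖Function.uncurry h p‖ ≤ C :=
    ((isCompact_closedBall z₀ (2 * δ)).prod isCompact_univ).exists_bound_of_continuousOn
      (hc.mono (prod_mono hball subset_rfl))
  have hmem : ∀ z ∈ Metric.ball z₀ δ, z ∈ U := fun z hz =>
    hball (Metric.ball_subset_closedBall (Metric.ball_subset_ball (by linarith) hz))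
  have hdiff : ∀ s, ∀ z ∈ Metric.ball z₀ δ,
      HasDerivAt (fun z => h z s) (deriv (fun z => h z s) z) z := fun s z hz =>
    ((hd s).differentiableAt (hU.mem_nhds (hmem z hz))).hasDerivAt
  have hmeas : AEStronglyMeasurable (fun s => deriv (fun z => h z s) z₀) ν := by
    have hsmall : ∀ n : ℕ, z₀ + ((δ / (n + 2) : ℝ) : ℂ) ∈ U := fun n => by
      refine hmem _ ?_
      rw [mem_ball_iff_norm, add_sub_cancel_left, Complex.norm_real, Real.norm_of_nonneg
        (by positivity), div_lt_iff₀ (by positivity)]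
      nlinarith [(n.cast_nonneg : (0 : ℝ) ≤ n)]
    have ht : Tendsto (fun n : ℕ => ((δ / (n + 2) : ℝ) : ℂ)) atTop (𝓝[≠] 0) := by
      refine tendsto_nhdsWithin_iff.mpr ⟨?_, Eventually.of_forall fun n => ?_⟩
      · rw [← Complex.ofReal_zero]
        refine (Complex.continuous_ofReal.tendsto 0).comp ?_
        exact tendsto_const_nhds.div_atTop
          (tendsto_atTop_add_const_right _ _ tendsto_natCast_atTop_atTop)
      · have : (0 : ℝ) < δ / (n + 2) := by positivity
        simpa using Complex.ofReal_ne_zero.mpr this.ne'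
    refine aestronglyMeasurable_of_tendsto_ae atTop
      (f := fun (n : ℕ) s => ((δ / (n + 2) : ℝ) : ℂ)⁻¹ • (h (z₀ + ((δ / (n + 2) : ℝ) : ℂ)) s - h z₀ s))
      (fun n => ?_) (Eventually.of_forall fun s => ?_)
    · exact (((hcz _ (hsmall n)).sub (hcz _ hz₀)).const_smul _).aestronglyMeasurable
    · exact (hasDerivAt_iff_tendsto_slope_zero.mp
        (hdiff s z₀ (Metric.mem_ball_self hδ))).comp ht
  refine (hasDerivAt_integral_of_dominated_loc_of_deriv_le (bound := fun _ => C / δ)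
    (Metric.ball_mem_nhds z₀ hδ) ?_ ?_ hmeas (Eventually.of_forall fun s z hz => ?_)
    (integrable_const _) (Eventually.of_forall hdiff)).2.differentiableAt.differentiableWithinAt
  · filter_upwards [hU.mem_nhds hz₀] with z hz using (hcz z hz).aestronglyMeasurable
  · exact (integrable_const C).mono' (hcz _ hz₀).aestronglyMeasurable
      (Eventually.of_forall fun s => hC (z₀, s) ⟨Metric.mem_closedBall_self (by positivity), mem_univ s⟩)
  · have hsub : Metric.closedBall z δ ⊆ Metric.closedBall z₀ (2 * δ) :=
      Metric.closedBall_subset_closedBall' (by have := Metric.mem_ball.mp hz; linarith)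
    refine Complex.norm_deriv_le_of_forall_mem_sphere_norm_le hδ ?_ fun w hw =>
      hC (w, s) ⟨hsub (Metric.sphere_subset_closedBall hw), mem_univ s⟩
    exact ((hd s).mono (hsub.trans hball)).diffContOnCl_ball subset_rfl

/-- The integrand `M (s + (1 - s) M)⁻¹` of the fractional powers of `M`. -/
noncomputable def powIntegrand {m : ℕ} (M : Matrix (Fin m) (Fin m) ℂ) (s : I) :
    Matrix (Fin m) (Fin m) ℂ :=
  M * (((s : ℝ) : ℂ) • 1 + ((1 - s : ℝ) : ℂ) • M)⁻¹

/-- `M` has no eigenvalue in `(-∞, 0]`. -/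
def AvoidsNonpos {m : ℕ} (M : Matrix (Fin m) (Fin m) ℂ) : Prop :=
  ∀ s : I, IsUnit (((s : ℝ) : ℂ) • 1 + ((1 - s : ℝ) : ℂ) • M)

lemma differentiableAt_inv_matrix {m : ℕ} {A : Matrix (Fin m) (Fin m) ℂ} (hA : IsUnit A) :
    DifferentiableAt ℂ (fun B : Matrix (Fin m) (Fin m) ℂ => B⁻¹) A := by
  simp_rw [nonsing_inv_eq_ringInverse]
  exact differentiableAt_inverse hA

lemma continuousOn_powIntegrand {m : ℕ} {U : Set ℂ} {M : ℂ → Matrix (Fin m) (Fin m) ℂ}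
    (hM : ContinuousOn M U) (hA : ∀ z ∈ U, AvoidsNonpos (M z)) :
    ContinuousOn (Function.uncurry fun z s => powIntegrand (M z) s) (U ×ˢ univ) := by
  have h1 : ContinuousOn (fun p : ℂ × I => M p.1) (U ×ˢ univ) :=
    hM.comp continuousOn_fst fun p hp => hp.1
  have h2 : ContinuousOn (fun p : ℂ × I => (((p.2 : ℝ) : ℂ) • (1 : Matrix (Fin m) (Fin m) ℂ)
      + ((1 - p.2 : ℝ) : ℂ) • M p.1)) (U ×ˢ univ) := by
    refine ContinuousOn.add (Continuous.continuousOn ?_)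
      (ContinuousOn.fun_smul (Continuous.continuousOn ?_) h1)
    · exact (Complex.continuous_ofReal.comp (continuous_subtype_val.comp continuous_snd)).smul
        continuous_const
    · exact Complex.continuous_ofReal.comp
        (continuous_const.sub (continuous_subtype_val.comp continuous_snd))
  refine h1.mul fun p hp => ?_
  exact ContinuousAt.comp_continuousWithinAt (g := fun B : Matrix (Fin m) (Fin m) ℂ => B⁻¹)
    (differentiableAt_inv_matrix (hA p.1 hp.1 p.2)).continuousAt (h2 p hp)

lemma continuous_powIntegrand {m : ℕ} {M : Matrix (Fin m) (Fin m) ℂ} (hA : AvoidsNonpos M) :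
    Continuous (powIntegrand M) := by
  rw [← continuousOn_univ]
  exact (continuousOn_powIntegrand (U := univ) (M := fun _ => M) continuousOn_const
    fun _ _ => hA).comp (f := fun s => ((0 : ℂ), s)) (by fun_prop) fun s _ => by simp

/-- The integral of `M (s + (1 - s) M)⁻¹`; a fractional power of `M` for suitable `ν`. -/
noncomputable def powIntegral {m : ℕ} (ν : Measure I) (M : Matrix (Fin m) (Fin m) ℂ) :
    Matrix (Fin m) (Fin m) ℂ :=
  ∫ s, powIntegrand M s ∂ν

lemma integrable_powIntegrand {m : ℕ} (ν : Measure I) [IsFiniteMeasure ν]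
    {M : Matrix (Fin m) (Fin m) ℂ} (hA : AvoidsNonpos M) : Integrable (powIntegrand M) ν := 
  (continuous_powIntegrand hA).integrable_of_hasCompactSupport
    (HasCompactSupport.of_compactSpace _)

lemma differentiableOn_powIntegral {m : ℕ} (ν : Measure I) [IsFiniteMeasure ν] {U : Set ℂ}
    (hU : IsOpen U) {M : ℂ → Matrix (Fin m) (Fin m) ℂ}
    (hM : DifferentiableOn ℂ M U) (hA : ∀ z ∈ U, AvoidsNonpos (M z)) :
    DifferentiableOn ℂ (fun z => powIntegral ν (M z)) U := by
  refine differentiableOn_integral_unitInterval ν hU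
    (continuousOn_powIntegrand hM.continuousOn hA) fun s => ?_
  refine hM.mul fun z hz => ?_
  have h2 : DifferentiableWithinAt ℂ (fun z => ((s : ℝ) : ℂ) • (1 : Matrix (Fin m) (Fin m) ℂ)
      + ((1 - s : ℝ) : ℂ) • M z) U z := ((hM z hz).fun_const_smul _).const_add _
  exact DifferentiableAt.comp_differentiableWithinAt (g := fun B : Matrix (Fin m) (Fin m) ℂ => B⁻¹)
    z (differentiableAt_inv_matrix (hA z hz s)) h2

/-- Linear maps commute with the integral defining `powIntegral`. -/
lemma map_powIntegral {m : ℕ} (ν : Measure I) [IsFiniteMeasure ν]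
    {M : Matrix (Fin m) (Fin m) ℂ} (hA : AvoidsNonpos M) {E : Type*} [NormedAddCommGroup E]
    [NormedSpace ℂ E] [CompleteSpace E] (L : Matrix (Fin m) (Fin m) ℂ →ₗ[ℂ] E) :
    L (powIntegral ν M) = ∫ s, L (powIntegrand M s) ∂ν :=
  ((LinearMap.toContinuousLinearMap L).integral_comp_comm (integrable_powIntegrand ν hA)).symm

lemma exists_measure_unitInterval_rpow {p : ℝ} (hp : p ∈ Ioo (0 : ℝ) 1) :
    ∃ ν : Measure I, IsFiniteMeasure ν ∧
      ∀ x : ℝ, 0 < x → ∫ s : I, x / (s + (1 - s) * x) ∂ν = x ^ p := by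
  obtain ⟨μ, hμ⟩ := Real.exists_measure_rpow_eq_integral_rpowIntegrand₀₁ hp
  let ρ : ℝ → ℝ := fun t => Real.rpowIntegrand₀₁ p t 1
  have hρm : Measurable ρ := by unfold ρ Real.rpowIntegrand₀₁; fun_prop
  let φ : ℝ → I := fun t => projIcc 0 1 zero_le_one (t / (1 + t))
  have hφ : Measurable φ := by
    refine continuous_projIcc.measurable.comp ?_
    fun_prop
  let μ' := (μ.restrict (Ioi 0)).withDensity fun t => ENNReal.ofReal (ρ t)
  have hfin : IsFiniteMeasure μ' :=
    isFiniteMeasure_withDensity_ofReal (hμ 1 (mem_Ici.mpr zero_le_one)).1.hasFiniteIntegral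
  refine ⟨μ'.map φ, inferInstance, fun x hx => ?_⟩
  rw [(hμ x hx.le).2, integral_map hφ.aemeasurable]
  · rw [integral_withDensity_eq_integral_toReal_smul (by fun_prop) (by simp)]
    refine setIntegral_congr_fun measurableSet_Ioi fun t ht => ?_
    have ht : 0 < t := ht
    have hmem : t / (1 + t) ∈ Icc (0 : ℝ) 1 :=
      ⟨by positivity, by rw [div_le_one (by positivity)]; linarith⟩
    have hρ0 : 0 ≤ ρ t := Real.rpowIntegrand₀₁_nonneg hp.1 ht.le zero_le_one
    rw [ENNReal.toReal_ofReal hρ0]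
    simp only [φ, projIcc_of_mem _ hmem, smul_eq_mul, ρ, Real.rpowIntegrand₀₁]
    have h1 : t / (1 + t) + (1 - t / (1 + t)) * x = (t + x) / (1 + t) := by field_simp; ring
    rw [h1]
    field_simp
    ring
  · have : Measurable fun s : I => x / ((s : ℝ) + (1 - s) * x) := by fun_prop
    exact this.aestronglyMeasurable

lemma add_mul_ne_zero_of_mem_slitPlane {z : ℂ} (hz : z ∈ Complex.slitPlane) (s : I) :
    ((s : ℝ) : ℂ) + ((1 - s : ℝ) : ℂ) * z ≠ 0 := by
  intro h
  have hs0 := s.2.1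
  have hs1 := s.2.2
  have him := congrArg Complex.im h
  have hre := congrArg Complex.re h
  simp at him hre
  rcases Complex.mem_slitPlane_iff.mp hz with h' | h'
  · rcases hs0.eq_or_lt with h0 | h0
    · simp [← h0] at hre; linarith
    · nlinarith [mul_nonneg (sub_nonneg.mpr hs1) h'.le]
  · have : (1 : ℝ) - s = 0 := him.resolve_right h'
    rw [this] at hre
    linarith

lemma integral_div_eq_cpow {p : ℝ} (ν : Measure I) [IsFiniteMeasure ν]
    (hν : ∀ x : ℝ, 0 < x → ∫ s : I, x / (s + (1 - s) * x) ∂ν = x ^ p)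
    {z : ℂ} (hz : z ∈ Complex.slitPlane) :
    ∫ s : I, z / (((s : ℝ) : ℂ) + ((1 - s : ℝ) : ℂ) * z) ∂ν = z ^ (p : ℂ) := by
  have hs : Continuous fun q : ℂ × I => ((q.2 : ℝ) : ℂ) :=
    Complex.continuous_ofReal.comp (continuous_subtype_val.comp continuous_snd)
  have hs' : Continuous fun q : ℂ × I => ((1 - q.2 : ℝ) : ℂ) :=
    Complex.continuous_ofReal.comp
      (continuous_const.sub (continuous_subtype_val.comp continuous_snd))
  have hd : DifferentiableOn ℂ
      (fun z => ∫ s : I, z / (((s : ℝ) : ℂ) + ((1 - s : ℝ) : ℂ) * z) ∂ν) Complex.slitPlane := by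
    refine differentiableOn_integral_unitInterval ν Complex.isOpen_slitPlane ?_ fun s => ?_
    · exact continuous_fst.continuousOn.div (hs.add (hs'.mul continuous_fst)).continuousOn
        fun q hq => add_mul_ne_zero_of_mem_slitPlane hq.1 q.2
    · exact differentiableOn_id.div (by fun_prop) fun w hw => add_mul_ne_zero_of_mem_slitPlane hw s
  have hd' : DifferentiableOn ℂ (fun z : ℂ => z ^ (p : ℂ)) Complex.slitPlane := fun w hw =>
    (differentiableAt_id.cpow_const hw).differentiableWithinAt
  have hconn : IsPreconnected Complex.slitPlane :=
    (Complex.starConvex_one_slitPlane.isPathConnected Complex.one_mem_slitPlane).isConnected.isPreconnected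
  refine (hd.analyticOnNhd Complex.isOpen_slitPlane).eqOn_of_preconnected_of_frequently_eq
    (hd'.analyticOnNhd Complex.isOpen_slitPlane) hconn (z₀ := 1) (by simp) ?_ hz
  have ht : Tendsto (fun x : ℝ => (x : ℂ)) (𝓝[>] 1) (𝓝[≠] 1) := by
    refine tendsto_nhdsWithin_iff.mpr ⟨?_, ?_⟩
    · exact (Complex.continuous_ofReal.tendsto' 1 1 (by simp)).mono_left nhdsWithin_le_nhds
    · filter_upwards [self_mem_nhdsWithin] with x hx
      simpa using (ne_of_gt hx : x ≠ 1)
  refine ht.frequently (Eventually.frequently ?_)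
  filter_upwards [self_mem_nhdsWithin] with x hx
  have hx : (0 : ℝ) < x := zero_lt_one.trans hx
  rw [← Complex.ofReal_cpow hx.le, ← hν x hx, ← integral_complex_ofReal]
  simp

lemma card_roots_charpoly {m : ℕ} (M : Matrix (Fin m) (Fin m) ℂ) :
    M.charpoly.roots.card = m := by
  rw [← (IsAlgClosed.splits M.charpoly).natDegree_eq_card_roots, charpoly_natDegree_eq_dim,
    Fintype.card_fin]

lemma det_smul_one_add_smul {m : ℕ} (M : Matrix (Fin m) (Fin m) ℂ) (a b : ℂ) :
    (a • (1 : Matrix (Fin m) (Fin m) ℂ) + b • M).det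
      = (M.charpoly.roots.map fun x => a + b * x).prod := by
  have hsplit := IsAlgClosed.splits M.charpoly
  rcases eq_or_ne b 0 with rfl | hb
  · simp [card_roots_charpoly]
  · have h1 : a • (1 : Matrix (Fin m) (Fin m) ℂ) + b • M
        = (-b) • (scalar (Fin m) (-a / b) - M) := by
      rw [scalar_apply, ← smul_one_eq_diagonal, smul_sub, smul_smul]
      simp [mul_div_cancel₀ _ hb]
    have h2 : (-b) ^ m = (M.charpoly.roots.map fun _ => -b).prod := by
      simp [card_roots_charpoly]
    rw [h1, det_smul, ← eval_charpoly, hsplit.eval_eq_prod_roots_of_monic M.charpoly_monic,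
      Fintype.card_fin, h2, ← Multiset.prod_map_mul]
    refine congrArg Multiset.prod (Multiset.map_congr rfl fun x _ => ?_)
    field_simp
    ring

lemma AvoidsNonpos.add_mul_ne_zero {m : ℕ} {M : Matrix (Fin m) (Fin m) ℂ} (hA : AvoidsNonpos M)
    {x : ℂ} (hx : x ∈ M.charpoly.roots) (s : I) :
    ((s : ℝ) : ℂ) + ((1 - s : ℝ) : ℂ) * x ≠ 0 := by
  have h := (isUnit_iff_isUnit_det _).mp (hA s)
  rw [det_smul_one_add_smul, isUnit_iff_ne_zero] at h
  exact fun h0 => h (Multiset.prod_eq_zero (Multiset.mem_map.mpr ⟨x, hx, h0⟩))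

lemma AvoidsNonpos.mem_slitPlane {m : ℕ} {M : Matrix (Fin m) (Fin m) ℂ} (hA : AvoidsNonpos M)
    {x : ℂ} (hx : x ∈ M.charpoly.roots) : x ∈ Complex.slitPlane := by
  rw [Complex.mem_slitPlane_iff]
  by_contra! hcon
  obtain ⟨hre, him⟩ := hcon
  have hden : 0 < 1 - x.re := by linarith
  refine hA.add_mul_ne_zero hx ⟨-x.re / (1 - x.re), ?_, ?_⟩ ?_
  · exact div_nonneg (by linarith) hden.le
  · rw [div_le_one hden]; linarith
  · have key : ((-x.re / (1 - x.re) : ℝ) : ℂ) + ((1 - -x.re / (1 - x.re) : ℝ) : ℂ) * x = 0 := by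
      refine Complex.ext ?_ ?_
      · simp only [Complex.add_re, Complex.mul_re, Complex.ofReal_re, Complex.ofReal_im,
          Complex.zero_re]
        field_simp
        ring
      · simp only [Complex.add_im, Complex.mul_im, Complex.ofReal_re, Complex.ofReal_im,
          Complex.zero_im, him]
        ring
    exact key

lemma roots_charpoly_powIntegrand {m : ℕ} {M : Matrix (Fin m) (Fin m) ℂ} (hA : AvoidsNonpos M)
    (s : I) : (powIntegrand M s).charpoly.roots
      = M.charpoly.roots.map fun x => x / (((s : ℝ) : ℂ) + ((1 - s : ℝ) : ℂ) * x) := by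
  set a := ((s : ℝ) : ℂ)
  set b := ((1 - s : ℝ) : ℂ)
  have hdet : IsUnit (a • (1 : Matrix (Fin m) (Fin m) ℂ) + b • M).det :=
    (isUnit_iff_isUnit_det _).mp (hA s)
  suffices h : (powIntegrand M s).charpoly
      = ((M.charpoly.roots.map fun x => x / (a + b * x)).map
          fun y => Polynomial.X - Polynomial.C y).prod by
    rw [h, Polynomial.roots_multiset_prod_X_sub_C]
  refine Polynomial.funext fun t => ?_
  have h1 : scalar (Fin m) t - powIntegrand M s
      = ((t * a) • 1 + (t * b - 1) • M) * (a • (1 : Matrix (Fin m) (Fin m) ℂ) + b • M)⁻¹ := by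
    have h2 : (t * a) • (1 : Matrix (Fin m) (Fin m) ℂ) + (t * b - 1) • M
        = t • (a • 1 + b • M) - M := by module
    rw [h2, sub_mul, smul_mul_assoc, mul_nonsing_inv _ hdet, scalar_apply, smul_one_eq_diagonal]
    rfl
  rw [eval_charpoly, h1, det_mul, det_nonsing_inv, Ring.inverse_eq_inv', det_smul_one_add_smul,
    det_smul_one_add_smul, Polynomial.eval_multiset_prod, Multiset.map_map, Multiset.map_map,
    ← Multiset.prod_map_inv, ← Multiset.prod_map_mul]
  refine congrArg Multiset.prod (Multiset.map_congr rfl fun x hx => ?_)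
  have : a + b * x ≠ 0 := hA.add_mul_ne_zero hx s
  simp only [Function.comp_apply, Polynomial.eval_sub, Polynomial.eval_X, Polynomial.eval_C]
  field_simp
  ring

lemma integral_multiset_sum_map {X ι : Type*} [MeasurableSpace X] {ν : Measure X}
    {f : ι → X → ℂ} (t : Multiset ι) (h : ∀ x ∈ t, Integrable (f x) ν) :
    Integrable (fun s => (t.map fun x => f x s).sum) ν ∧
      ∫ s, (t.map fun x => f x s).sum ∂ν = (t.map fun x => ∫ s, f x s ∂ν).sum := by
  induction t using Multiset.induction_on with
  | empty => simp
  | cons a t ih =>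
    obtain ⟨h1, h2⟩ := ih fun x hx => h x (Multiset.mem_cons_of_mem hx)
    have h0 := h a (Multiset.mem_cons_self a t)
    simp only [Multiset.map_cons, Multiset.sum_cons]
    exact ⟨h0.add h1, by rw [integral_add h0 h1, h2]⟩

lemma trace_powIntegral {m : ℕ} {p : ℝ} (ν : Measure I) [IsFiniteMeasure ν]
    (hν : ∀ x : ℝ, 0 < x → ∫ s : I, x / (s + (1 - s) * x) ∂ν = x ^ p)
    {M : Matrix (Fin m) (Fin m) ℂ} (hA : AvoidsNonpos M) :
    (powIntegral ν M).trace = (M.charpoly.roots.map fun x => x ^ (p : ℂ)).sum := by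
  have h1 := map_powIntegral ν hA (traceLinearMap (Fin m) ℂ ℂ)
  simp only [traceLinearMap_apply] at h1
  simp_rw [h1, trace_eq_sum_roots_charpoly, roots_charpoly_powIntegrand hA]
  rw [(integral_multiset_sum_map M.charpoly.roots fun x hx => ?_).2]
  · refine congrArg Multiset.sum (Multiset.map_congr rfl fun x hx => ?_)
    exact integral_div_eq_cpow ν hν (hA.mem_slitPlane hx)
  · refine Continuous.integrable_of_hasCompactSupport ?_ (HasCompactSupport.of_compactSpace _)
    refine continuous_const.div ?_ fun s => hA.add_mul_ne_zero hx s
    have h1 : Continuous fun s : I => ((s : ℝ) : ℂ) :=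
      Complex.continuous_ofReal.comp continuous_subtype_val
    have h2 : Continuous fun s : I => ((1 - s : ℝ) : ℂ) :=
      Complex.continuous_ofReal.comp (continuous_const.sub continuous_subtype_val)
    exact h1.add (h2.mul continuous_const)

/-- The quadratic form `M ↦ ⟨v, M v⟩` as a linear functional of the matrix. -/
def quadForm {m : ℕ} (v : Fin m → ℂ) : Matrix (Fin m) (Fin m) ℂ →ₗ[ℂ] ℂ where
  toFun M := star v ⬝ᵥ M *ᵥ v
  map_add' M N := by rw [add_mulVec, dotProduct_add]
  map_smul' c M := by rw [smul_mulVec, dotProduct_smul, RingHom.id_apply]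

lemma quadForm_apply {m : ℕ} (v : Fin m → ℂ) (M : Matrix (Fin m) (Fin m) ℂ) :
    quadForm v M = star v ⬝ᵥ M *ᵥ v := rfl

/-- The numerical range of `M` lies in the open right half-plane. -/
def IsAccretive {m : ℕ} (M : Matrix (Fin m) (Fin m) ℂ) : Prop :=
  ∀ v, v ≠ 0 → 0 < (quadForm v M).re

lemma star_dotProduct_self_eq {m : ℕ} (v : Fin m → ℂ) :
    ∃ r : ℝ, star v ⬝ᵥ v = r ∧ 0 ≤ r ∧ (v ≠ 0 → 0 < r) := by
  have h := RCLike.nonneg_iff.mp (dotProduct_star_self_nonneg v)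
  refine ⟨(star v ⬝ᵥ v).re, Complex.ext rfl ?_, h.1, fun hv => ?_⟩
  · simpa using h.2
  · exact (RCLike.pos_iff.mp (dotProduct_star_self_pos_iff.mpr hv)).1

lemma Matrix.PosDef.isAccretive {m : ℕ} {M : Matrix (Fin m) (Fin m) ℂ} (hM : M.PosDef) :
    IsAccretive M := fun _ hv => (RCLike.pos_iff.mp (hM.dotProduct_mulVec_pos hv)).1

lemma avoidsNonpos_of_eigenvalues {m : ℕ} {M : Matrix (Fin m) (Fin m) ℂ}
    (h : ∀ v, v ≠ 0 → ∀ x : ℂ, M *ᵥ v = x • v → x ∈ Complex.slitPlane) : AvoidsNonpos M := by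
  intro s
  rw [isUnit_iff_isUnit_det, isUnit_iff_ne_zero]
  intro hdet
  obtain ⟨v, hv, hMv⟩ := exists_mulVec_eq_zero_iff.mpr hdet
  rw [add_mulVec, smul_mulVec, smul_mulVec, one_mulVec] at hMv
  rcases eq_or_ne (1 - (s : ℝ)) 0 with h1 | h1
  · have h2 : (s : ℝ) = 1 := by linarith
    rw [h1, h2] at hMv
    simp [hv] at hMv
  · have h1' : ((1 - s : ℝ) : ℂ) ≠ 0 := Complex.ofReal_ne_zero.mpr h1
    have hMv' : M *ᵥ v = ((-(s / (1 - s)) : ℝ) : ℂ) • v := by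
      have h3 : ((1 - s : ℝ) : ℂ) • M *ᵥ v = ((1 - s : ℝ) : ℂ) • ((-(s / (1 - s)) : ℝ) : ℂ) • v := by
        rw [eq_neg_of_add_eq_zero_right hMv, smul_smul, ← Complex.ofReal_mul, ← neg_smul,
          ← Complex.ofReal_neg]
        congr 2
        field_simp
      exact smul_right_injective _ h1' h3
    have h4 := h v hv _ hMv'
    rw [Complex.ofReal_mem_slitPlane] at h4
    have : 0 ≤ (s : ℝ) / (1 - s) := div_nonneg s.2.1 (sub_nonneg.mpr s.2.2)
    linarith

lemma arg_mul_of_abs_lt {a b : ℂ} (ha : a ≠ 0) (hb : b ≠ 0) (h : |a.arg| + |b.arg| < Real.pi) :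
    (a * b).arg = a.arg + b.arg ∧ a * b ∈ Complex.slitPlane := by
  have h1 := abs_lt.mp ((abs_add_le _ _).trans_lt h)
  have h2 := Complex.arg_mul ha hb ⟨h1.1, h1.2.le⟩
  exact ⟨h2, Complex.mem_slitPlane_iff_arg.mpr ⟨by rw [h2]; exact h1.2.ne, mul_ne_zero ha hb⟩⟩

lemma quadForm_eq_of_mulVec_eq {m : ℕ} {M : Matrix (Fin m) (Fin m) ℂ} {v : Fin m → ℂ} {x : ℂ}
    (h : M *ᵥ v = x • v) : quadForm v M = x * (star v ⬝ᵥ v) := by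
  rw [quadForm_apply, h, dotProduct_smul, smul_eq_mul]

lemma IsAccretive.avoidsNonpos_smul {m : ℕ} {M : Matrix (Fin m) (Fin m) ℂ} (hM : IsAccretive M)
    {c : ℂ} (hc : c ≠ 0) (hc' : 0 ≤ c.re) : AvoidsNonpos (c • M) := by
  refine avoidsNonpos_of_eigenvalues fun v hv x hx => ?_
  have h1 := quadForm_eq_of_mulVec_eq hx
  obtain ⟨r, hr, -, hr'⟩ := star_dotProduct_self_eq v
  have hr0 := hr' hv
  rw [map_smul, smul_eq_mul, hr] at h1
  have h2 : x = c * (quadForm v M * ((r⁻¹ : ℝ) : ℂ)) := by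
    rw [← mul_assoc, h1, mul_assoc, ← Complex.ofReal_mul, mul_inv_cancel₀ hr0.ne']
    simp
  have hpos : 0 < (quadForm v M * ((r⁻¹ : ℝ) : ℂ)).re := by
    rw [Complex.re_mul_ofReal]
    exact mul_pos (hM v hv) (inv_pos.mpr hr0)
  have hne : quadForm v M * ((r⁻¹ : ℝ) : ℂ) ≠ 0 := fun h0 => by
    rw [h0, Complex.zero_re] at hpos
    exact lt_irrefl _ hpos
  rw [h2]
  refine (arg_mul_of_abs_lt hc hne ?_).2
  have h3 := Complex.abs_arg_le_pi_div_two_iff.mpr hc'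
  have h4 := Complex.abs_arg_lt_pi_div_two_iff.mpr (Or.inl hpos)
  linarith

lemma IsAccretive.avoidsNonpos {m : ℕ} {M : Matrix (Fin m) (Fin m) ℂ} (hM : IsAccretive M) :
    AvoidsNonpos M := by
  simpa using hM.avoidsNonpos_smul one_ne_zero (by simp)

lemma quadForm_powIntegrand {m : ℕ} {M : Matrix (Fin m) (Fin m) ℂ} (hM : AvoidsNonpos M)
    (s : I) (v : Fin m → ℂ) : ∃ w : Fin m → ℂ, (v ≠ 0 → w ≠ 0) ∧
      quadForm v (powIntegrand M s) = ((s : ℝ) : ℂ) * quadForm w M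
        + ((1 - s : ℝ) : ℂ) * (star (M *ᵥ w) ⬝ᵥ (M *ᵥ w)) := by
  set D := ((s : ℝ) : ℂ) • (1 : Matrix (Fin m) (Fin m) ℂ) + ((1 - s : ℝ) : ℂ) • M with hD
  have hdet : IsUnit D.det := (isUnit_iff_isUnit_det _).mp (hM s)
  have hv : v = D *ᵥ (D⁻¹ *ᵥ v) := by rw [mulVec_mulVec, mul_nonsing_inv _ hdet, one_mulVec]
  refine ⟨D⁻¹ *ᵥ v, fun h0 h => h0 (by rw [hv, h, mulVec_zero]), ?_⟩
  have h1 : quadForm v (powIntegrand M s) = star v ⬝ᵥ M *ᵥ (D⁻¹ *ᵥ v) := by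
    rw [mulVec_mulVec]; rfl
  rw [h1]
  set w := D⁻¹ *ᵥ v
  rw [hv, hD, add_mulVec, smul_mulVec, smul_mulVec, one_mulVec, star_add, star_smul, star_smul,
    add_dotProduct, smul_dotProduct, smul_dotProduct, quadForm_apply]
  simp

lemma measure_ne_zero_of_rpow {p : ℝ} {ν : Measure I}
    (hν : ∀ x : ℝ, 0 < x → ∫ s : I, x / (s + (1 - s) * x) ∂ν = x ^ p) : ν ≠ 0 := by
  rintro rfl
  simpa using hν 1 one_pos

lemma quadForm_powIntegral {m : ℕ} (ν : Measure I) [IsFiniteMeasure ν]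
    {M : Matrix (Fin m) (Fin m) ℂ} (hM : AvoidsNonpos M) (v : Fin m → ℂ) :
    Integrable (fun s => quadForm v (powIntegrand M s)) ν ∧
      quadForm v (powIntegral ν M) = ∫ s, quadForm v (powIntegrand M s) ∂ν :=
  ⟨(LinearMap.toContinuousLinearMap (quadForm v)).integrable_comp (integrable_powIntegrand ν hM),
    map_powIntegral ν hM (quadForm v)⟩

lemma IsAccretive.isAccretive_powIntegral {m : ℕ} {ν : Measure I} [IsFiniteMeasure ν] (hν : ν ≠ 0)
    {M : Matrix (Fin m) (Fin m) ℂ} (hM : IsAccretive M) : IsAccretive (powIntegral ν M) := by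
  intro v hv
  obtain ⟨hi, h⟩ := quadForm_powIntegral ν hM.avoidsNonpos v
  have hpos : ∀ s, 0 < (quadForm v (powIntegrand M s)).re := fun s => by
    obtain ⟨w, hw, h⟩ := quadForm_powIntegrand hM.avoidsNonpos s v
    obtain ⟨r, hr, hr0, hr'⟩ := star_dotProduct_self_eq (M *ᵥ w)
    rw [h, hr, Complex.add_re, Complex.re_ofReal_mul, Complex.re_ofReal_mul, Complex.ofReal_re]
    have h1 := hM w (hw hv)
    have h2 : 0 < r := hr' fun h0 => by
      simp [quadForm_apply, h0] at h1
    rcases s.2.1.eq_or_lt with h0 | h0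
    · rw [← h0]; simpa using h2
    · exact add_pos_of_pos_of_nonneg (mul_pos h0 h1) (mul_nonneg (sub_nonneg.mpr s.2.2) hr0)
  rw [h, ← Complex.reCLM_apply, ← Complex.reCLM.integral_comp_comm hi]
  refine (integral_pos_iff_support_of_nonneg (fun s => (hpos s).le)
    (Complex.reCLM.integrable_comp hi)).mpr ?_
  have : Function.support (fun s => (quadForm v (powIntegrand M s)).re) = univ :=
    eq_univ_of_forall fun s => (hpos s).ne'
  rw [this]
  exact (Measure.measure_univ_pos).mpr hν

lemma im_quadForm_powIntegral_nonneg {m : ℕ} (ν : Measure I) [IsFiniteMeasure ν] (ε : ℝ)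
    {M : Matrix (Fin m) (Fin m) ℂ} (hM : AvoidsNonpos M)
    (h : ∀ w, 0 ≤ ε * (quadForm w M).im) (v : Fin m → ℂ) :
    0 ≤ ε * (quadForm v (powIntegral ν M)).im := by
  obtain ⟨hi, h'⟩ := quadForm_powIntegral ν hM v
  rw [h', ← Complex.imCLM_apply, ← Complex.imCLM.integral_comp_comm hi, ← integral_const_mul]
  refine integral_nonneg fun s => ?_
  obtain ⟨w, -, hw⟩ := quadForm_powIntegrand hM s v
  obtain ⟨r, hr, -⟩ := star_dotProduct_self_eq (M *ᵥ w)
  simp only [Complex.imCLM_apply, Pi.zero_apply]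
  rw [hw, hr, Complex.add_im, Complex.im_ofReal_mul, Complex.im_ofReal_mul, Complex.ofReal_im,
    mul_zero, add_zero, mul_left_comm]
  exact mul_nonneg s.2.1 (h w)

lemma powIntegral_conj {m : ℕ} (ν : Measure I) [IsFiniteMeasure ν]
    {M V W : Matrix (Fin m) (Fin m) ℂ} (hM : AvoidsNonpos M) (hVW : V * W = 1) :
    powIntegral ν (V * M * W) = V * powIntegral ν M * W := by
  have hWV : W * V = 1 := mul_eq_one_comm.mp hVW
  have h1 : ∀ s, powIntegrand (V * M * W) s = V * powIntegrand M s * W := fun s => by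
    have hdet := (isUnit_iff_isUnit_det _).mp (hM s)
    unfold powIntegrand
    set D := ((s : ℝ) : ℂ) • (1 : Matrix (Fin m) (Fin m) ℂ) + ((1 - s : ℝ) : ℂ) • M with hD
    have h2 : ((s : ℝ) : ℂ) • (1 : Matrix (Fin m) (Fin m) ℂ) + ((1 - s : ℝ) : ℂ) • (V * M * W)
        = V * D * W := by
      rw [hD, mul_add, add_mul, mul_smul_comm, smul_mul_assoc, mul_one, hVW, mul_smul_comm,
        smul_mul_assoc]
    have h3 : (V * D * W)⁻¹ = V * D⁻¹ * W := by
      refine inv_eq_right_inv ?_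
      calc V * D * W * (V * D⁻¹ * W) = V * D * (W * V) * D⁻¹ * W := by simp only [mul_assoc]
        _ = V * (D * D⁻¹) * W := by rw [hWV]; simp only [mul_assoc, one_mul]
        _ = 1 := by rw [mul_nonsing_inv _ hdet, mul_one, hVW]
    rw [h2, h3]
    calc V * M * W * (V * D⁻¹ * W) = V * M * (W * V) * D⁻¹ * W := by simp only [mul_assoc]
      _ = _ := by rw [hWV]; simp only [mul_assoc, one_mul]
  have h2 := map_powIntegral ν hM ((LinearMap.mulRight ℂ W).comp (LinearMap.mulLeft ℂ V))
  simp only [LinearMap.comp_apply, LinearMap.mulLeft_apply, LinearMap.mulRight_apply] at h2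
  rw [h2, powIntegral]
  simp_rw [h1]

lemma avoidsNonpos_diagonal {m : ℕ} {d : Fin m → ℂ} (hd : ∀ i, d i ∈ Complex.slitPlane) :
    AvoidsNonpos (diagonal d) := by
  intro s
  rw [smul_one_eq_diagonal, ← diagonal_smul, diagonal_add, isUnit_iff_isUnit_det, det_diagonal,
    isUnit_iff_ne_zero]
  exact Finset.prod_ne_zero_iff.mpr fun i _ => add_mul_ne_zero_of_mem_slitPlane (hd i) s

lemma powIntegral_diagonal {m : ℕ} {p : ℝ} (ν : Measure I) [IsFiniteMeasure ν]
    (hν : ∀ x : ℝ, 0 < x → ∫ s : I, x / (s + (1 - s) * x) ∂ν = x ^ p)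
    {d : Fin m → ℂ} (hd : ∀ i, d i ∈ Complex.slitPlane) :
    powIntegral ν (diagonal d) = diagonal fun i => d i ^ (p : ℂ) := by
  have h1 : ∀ s, powIntegrand (diagonal d) s
      = diagonal fun i => d i / (((s : ℝ) : ℂ) + ((1 - s : ℝ) : ℂ) * d i) := fun s => by
    have h2 : (((s : ℝ) : ℂ) • (1 : Matrix (Fin m) (Fin m) ℂ)
        + ((1 - s : ℝ) : ℂ) • diagonal d)⁻¹
        = diagonal fun i => (((s : ℝ) : ℂ) + ((1 - s : ℝ) : ℂ) * d i)⁻¹ := by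
      refine inv_eq_right_inv ?_
      rw [smul_one_eq_diagonal, ← diagonal_smul, diagonal_add, diagonal_mul_diagonal,
        ← diagonal_one]
      congr 1
      ext i
      exact mul_inv_cancel₀ (add_mul_ne_zero_of_mem_slitPlane (hd i) s)
    rw [powIntegrand, h2, diagonal_mul_diagonal]
    rfl
  ext i j
  have h2 := map_powIntegral ν (avoidsNonpos_diagonal hd) (entryLinearMap ℂ ℂ i j)
  simp only [entryLinearMap_apply, h1] at h2
  rw [h2]
  rcases eq_or_ne i j with rfl | hij
  · simp only [diagonal_apply_eq]
    exact integral_div_eq_cpow ν hν (hd i)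
  · simp [diagonal_apply_ne _ hij]

lemma mul_ofReal_cpow {c : ℂ} (hc : c ≠ 0) {x : ℝ} (hx : 0 < x) (p : ℝ) :
    (c * x) ^ (p : ℂ) = c ^ (p : ℂ) * ((x ^ p : ℝ) : ℂ) := by
  have hx' : (x : ℂ) ≠ 0 := Complex.ofReal_ne_zero.mpr hx.ne'
  rw [Complex.ofReal_cpow hx.le, Complex.cpow_def_of_ne_zero (mul_ne_zero hc hx'),
    Complex.cpow_def_of_ne_zero hc, Complex.cpow_def_of_ne_zero hx', Complex.log_mul_ofReal x hx c hc,
    Complex.ofReal_log hx.le, ← Complex.exp_add]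
  ring_nf

/-- A positive definite matrix is unitarily diagonalizable, and `mpow` acts on eigenvalues. -/
lemma Matrix.PosDef.exists_diagonal {m : ℕ} {X : Matrix (Fin m) (Fin m) ℂ} (hX : X.PosDef) :
    ∃ (U : Matrix (Fin m) (Fin m) ℂ) (d : Fin m → ℝ), U * star U = 1 ∧ (∀ i, 0 < d i) ∧
      X = U * diagonal (fun i => (d i : ℂ)) * star U ∧
      ∀ p, mpow X p = U * diagonal (fun i => ((d i ^ p : ℝ) : ℂ)) * star U := by
  refine ⟨hX.1.eigenvectorUnitary, hX.1.eigenvalues, ?_, hX.eigenvalues_pos, ?_, fun p => ?_⟩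
  · exact Unitary.mul_star_self_of_mem hX.1.eigenvectorUnitary.2
  · have := hX.1.spectral_theorem
    rw [Unitary.conjStarAlgAut_apply] at this
    exact this
  · rw [mpow, hX.1.cfc_eq, IsHermitian.cfc, Unitary.conjStarAlgAut_apply]
    rfl

lemma powIntegral_smul_posDef {m : ℕ} {p : ℝ} (ν : Measure I) [IsFiniteMeasure ν]
    (hν : ∀ x : ℝ, 0 < x → ∫ s : I, x / (s + (1 - s) * x) ∂ν = x ^ p)
    {c : ℂ} (hc : c ∈ Complex.slitPlane) {X : Matrix (Fin m) (Fin m) ℂ} (hX : X.PosDef) :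
    powIntegral ν (c • X) = c ^ (p : ℂ) • mpow X p := by
  obtain ⟨U, d, hU, hd, hX', hp⟩ := hX.exists_diagonal
  have hc0 := Complex.slitPlane_ne_zero hc
  have h1 : ∀ i, c * (d i : ℂ) ∈ Complex.slitPlane := fun i => by
    rw [mul_comm, Complex.mem_slitPlane_iff, Complex.re_ofReal_mul, Complex.im_ofReal_mul]
    exact (Complex.mem_slitPlane_iff.mp hc).imp (mul_pos (hd i)) (mul_ne_zero (hd i).ne')
  have h2 : c • X = U * diagonal (fun i => c * (d i : ℂ)) * star U := by
    rw [hX', ← smul_mul_assoc, ← mul_smul_comm, ← diagonal_smul]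
    rfl
  rw [h2, powIntegral_conj ν (avoidsNonpos_diagonal h1) hU, powIntegral_diagonal ν hν h1, hp,
    ← smul_mul_assoc, ← mul_smul_comm, ← diagonal_smul]
  congr 3
  ext i
  exact mul_ofReal_cpow hc0 (hd i) p

lemma powIntegral_posDef {m : ℕ} {p : ℝ} (ν : Measure I) [IsFiniteMeasure ν]
    (hν : ∀ x : ℝ, 0 < x → ∫ s : I, x / (s + (1 - s) * x) ∂ν = x ^ p)
    {X : Matrix (Fin m) (Fin m) ℂ} (hX : X.PosDef) : powIntegral ν X = mpow X p := by
  simpa using powIntegral_smul_posDef ν hν Complex.one_mem_slitPlane hX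

lemma mpow_one_right {m : ℕ} {X : Matrix (Fin m) (Fin m) ℂ} (hX : X.PosDef) : mpow X 1 = X := by
  obtain ⟨U, d, -, -, hX', hp⟩ := hX.exists_diagonal
  rw [hp 1]
  simp_rw [Real.rpow_one]
  exact hX'.symm

lemma mpow_smul {m : ℕ} {X : Matrix (Fin m) (Fin m) ℂ} (hX : X.PosDef) {c : ℝ} (hc : 0 < c)
    (p : ℝ) : mpow (c • X) p = (c ^ p : ℝ) • mpow X p := by
  have hf : ∀ (f : ℝ → ℝ) (Y : Matrix (Fin m) (Fin m) ℂ), ContinuousOn f (spectrum ℝ Y) :=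
    fun f Y => Matrix.finite_real_spectrum.continuousOn f
  have hX' : IsSelfAdjoint X := hX.1
  rw [mpow, mpow, ← cfc_comp_smul c _ X ((Matrix.finite_real_spectrum.image _).continuousOn _),
    ← cfc_smul _ _ _ (hf _ _)]
  refine cfc_congr fun x hx => ?_
  have hx0 : 0 < x := by
    rw [hX.1.spectrum_real_eq_range_eigenvalues] at hx
    obtain ⟨i, rfl⟩ := hx
    exact hX.eigenvalues_pos i
  simp only [smul_eq_mul]
  exact Real.mul_rpow hc.le hx0.le

lemma mpow_half_mul_self {m : ℕ} {X : Matrix (Fin m) (Fin m) ℂ} (hX : X.PosDef) :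
    mpow X (1 / 2) * mpow X (1 / 2) = X := by
  obtain ⟨U, d, hU, hd, hX', hp⟩ := hX.exists_diagonal
  have hU' : star U * U = 1 := mul_eq_one_comm.mp hU
  rw [hp]
  calc _ = U * diagonal (fun i => ((d i ^ (1 / 2 : ℝ) : ℝ) : ℂ)) * (star U * U)
        * diagonal (fun i => ((d i ^ (1 / 2 : ℝ) : ℝ) : ℂ)) * star U := by simp only [mul_assoc]
    _ = _ := by
      rw [hU', mul_one, mul_assoc U, diagonal_mul_diagonal]
      conv_rhs => rw [hX']
      congr 3
      ext i
      rw [← Complex.ofReal_mul, ← Real.rpow_add (hd i)]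
      norm_num

lemma mpow_posDef {m : ℕ} {X : Matrix (Fin m) (Fin m) ℂ} (hX : X.PosDef) (p : ℝ) :
    (mpow X p).PosDef := by
  obtain ⟨U, d, hU, hd, hX', hp⟩ := hX.exists_diagonal
  rw [hp]
  refine PosDef.mul_mul_conjTranspose_same (posDef_diagonal_iff.mpr fun i => ?_) ?_
  · exact_mod_cast Real.rpow_pos_of_pos (hd i) p
  · exact vecMul_injective_of_isUnit (IsUnit.of_mul_eq_one _ hU)

/-- The open right half-plane. -/
def rightHalfPlane : Set ℂ := {u | 0 < u.re}

lemma isOpen_rightHalfPlane : IsOpen rightHalfPlane :=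
  isOpen_lt continuous_const Complex.continuous_re

lemma isPreconnected_rightHalfPlane : IsPreconnected rightHalfPlane :=
  (convex_halfSpace_re_gt 0).isPreconnected

/-- Holomorphic functions on the right half-plane that agree on the positive reals agree. -/
lemma eqOn_rightHalfPlane {E : Type*} [NormedAddCommGroup E] [NormedSpace ℂ E] [CompleteSpace E]
    {f g : ℂ → E} (hf : DifferentiableOn ℂ f rightHalfPlane)
    (hg : DifferentiableOn ℂ g rightHalfPlane) (h : ∀ x : ℝ, 0 < x → f x = g x) :
    EqOn f g rightHalfPlane := by
  refine (hf.analyticOnNhd isOpen_rightHalfPlane).eqOn_of_preconnected_of_frequently_eq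
    (hg.analyticOnNhd isOpen_rightHalfPlane) isPreconnected_rightHalfPlane (z₀ := 1)
    (by simp [rightHalfPlane]) ?_
  have ht : Tendsto (fun x : ℝ => (x : ℂ)) (𝓝[>] 1) (𝓝[≠] 1) := by
    refine tendsto_nhdsWithin_iff.mpr ⟨?_, ?_⟩
    · exact (Complex.continuous_ofReal.tendsto' 1 1 (by simp)).mono_left nhdsWithin_le_nhds
    · filter_upwards [self_mem_nhdsWithin] with x hx
      simpa using (ne_of_gt hx : x ≠ 1)
  refine ht.frequently (Eventually.frequently ?_)
  filter_upwards [self_mem_nhdsWithin] with x hx using h x (zero_lt_one.trans hx)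

lemma powIntegral_smul_eq {m : ℕ} {p : ℝ} (ν : Measure I) [IsFiniteMeasure ν]
    (hν : ∀ x : ℝ, 0 < x → ∫ s : I, x / (s + (1 - s) * x) ∂ν = x ^ p)
    {B : ℂ → Matrix (Fin m) (Fin m) ℂ} (hB : DifferentiableOn ℂ B rightHalfPlane)
    (hacc : ∀ u ∈ rightHalfPlane, IsAccretive (B u)) (hpos : ∀ x : ℝ, 0 < x → (B x).PosDef)
    {c : ℂ} (hc : c ∈ Complex.slitPlane) (hc' : 0 ≤ c.re) {u : ℂ} (hu : u ∈ rightHalfPlane) :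
    powIntegral ν (c • B u) = c ^ (p : ℂ) • powIntegral ν (B u) := by
  refine eqOn_rightHalfPlane (f := fun u => powIntegral ν (c • B u))
    (g := fun u => c ^ (p : ℂ) • powIntegral ν (B u)) ?_ ?_ (fun x hx => ?_) hu
  · exact differentiableOn_powIntegral ν isOpen_rightHalfPlane (hB.fun_const_smul c) fun z hz =>
      (hacc z hz).avoidsNonpos_smul (Complex.slitPlane_ne_zero hc) hc'
  · exact (differentiableOn_powIntegral ν isOpen_rightHalfPlane hB fun z hz =>
      (hacc z hz).avoidsNonpos).fun_const_smul _
  · rw [powIntegral_smul_posDef ν hν hc (hpos x hx), powIntegral_posDef ν hν (hpos x hx)]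

lemma I_cpow (p : ℝ) : Complex.I ^ (p : ℂ) = Complex.exp (((p * (Real.pi / 2) : ℝ) : ℂ) * Complex.I) := by
  rw [Complex.cpow_def_of_ne_zero Complex.I_ne_zero, Complex.log_I]
  push_cast
  ring_nf

lemma neg_I_cpow (p : ℝ) :
    (-Complex.I) ^ (p : ℂ) = Complex.exp (((-(p * (Real.pi / 2)) : ℝ) : ℂ) * Complex.I) := by
  rw [Complex.cpow_def_of_ne_zero (neg_ne_zero.mpr Complex.I_ne_zero), Complex.log_neg_I]
  push_cast
  ring_nf

lemma exp_mul_im (a : ℝ) (q : ℂ) :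
    (Complex.exp ((a : ℂ) * Complex.I) * q).im = ‖q‖ * Real.sin (a + q.arg) := by
  conv_lhs => rw [← Complex.norm_mul_exp_arg_mul_I q]
  rw [mul_left_comm, ← Complex.exp_add, ← add_mul, ← Complex.ofReal_add, Complex.im_ofReal_mul,
    Complex.exp_ofReal_mul_I_im]

lemma abs_arg_le_of_rotations {q : ℂ} {a : ℝ} (ha : a ∈ Ioo 0 (Real.pi / 2)) (hq : 0 < q.re)
    (h1 : 0 ≤ (Complex.exp ((a : ℂ) * Complex.I) * q).im)
    (h2 : (Complex.exp (((-a : ℝ) : ℂ) * Complex.I) * q).im ≤ 0) : |q.arg| ≤ a := by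
  have hq0 : q ≠ 0 := fun h => by simp [h] at hq
  have hn : 0 < ‖q‖ := norm_pos_iff.mpr hq0
  rw [exp_mul_im] at h1 h2
  have harg := abs_lt.mp (Complex.abs_arg_lt_pi_div_two_iff.mpr (Or.inl hq))
  rw [abs_le]
  have hpi := Real.pi_pos
  constructor
  · by_contra! h
    have := Real.sin_neg_of_neg_of_neg_pi_lt (x := a + q.arg) (by linarith) (by linarith [ha.1])
    nlinarith
  · by_contra! h
    have := Real.sin_pos_of_pos_of_lt_pi (x := -a + q.arg) (by linarith) (by linarith [ha.1])
    nlinarith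

/-- Fractional powers of a holomorphic accretive family extend holomorphically, and their
numerical range lies in the corresponding smaller sector. -/
lemma exists_holomorphic_mpow {m : ℕ} {p : ℝ} (hp : p ∈ Ioc (0 : ℝ) 1)
    {B : ℂ → Matrix (Fin m) (Fin m) ℂ} (hB : DifferentiableOn ℂ B rightHalfPlane)
    (hacc : ∀ u ∈ rightHalfPlane, IsAccretive (B u)) (hpos : ∀ x : ℝ, 0 < x → (B x).PosDef) :
    ∃ C : ℂ → Matrix (Fin m) (Fin m) ℂ, DifferentiableOn ℂ C rightHalfPlane ∧
      (∀ x : ℝ, 0 < x → C x = mpow (B x) p) ∧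
      ∀ u ∈ rightHalfPlane, ∀ v, v ≠ 0 → 0 < (quadForm v (C u)).re ∧
        |(quadForm v (C u)).arg| ≤ p * (Real.pi / 2) := by
  rcases hp.2.eq_or_lt with rfl | hp1
  · refine ⟨B, hB, fun x hx => (mpow_one_right (hpos x hx)).symm, fun u hu v hv => ?_⟩
    refine ⟨hacc u hu v hv, ?_⟩
    rw [one_mul]
    exact Complex.abs_arg_le_pi_div_two_iff.mpr (hacc u hu v hv).le
  obtain ⟨ν, hfin, hν⟩ := exists_measure_unitInterval_rpow ⟨hp.1, hp1⟩
  refine ⟨fun u => powIntegral ν (B u), differentiableOn_powIntegral ν isOpen_rightHalfPlane hB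
    fun z hz => (hacc z hz).avoidsNonpos, fun x hx => powIntegral_posDef ν hν (hpos x hx),
    fun u hu v hv => ?_⟩
  have hre := (hacc u hu).isAccretive_powIntegral (measure_ne_zero_of_rpow hν) v hv
  have hre' : ∀ w, 0 ≤ (quadForm w (B u)).re := fun w => by
    rcases eq_or_ne w 0 with rfl | hw
    · simp [quadForm_apply]
    · exact (hacc u hu w hw).le
  refine ⟨hre, abs_arg_le_of_rotations ⟨?_, ?_⟩ hre ?_ ?_⟩
  · have := hp.1
    positivity
  · have := Real.pi_pos
    nlinarith
  · have h := im_quadForm_powIntegral_nonneg ν 1 ((hacc u hu).avoidsNonpos_smul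
      Complex.I_ne_zero (by simp)) (fun w => by simpa using hre' w) v
    rw [powIntegral_smul_eq ν hν hB hacc hpos (by simp [Complex.mem_slitPlane_iff]) (by simp) hu,
      I_cpow, map_smul, smul_eq_mul, one_mul] at h
    exact h
  · have h := im_quadForm_powIntegral_nonneg ν (-1) ((hacc u hu).avoidsNonpos_smul
      (neg_ne_zero.mpr Complex.I_ne_zero) (by simp)) (fun w => by simpa using hre' w) v
    rw [powIntegral_smul_eq ν hν hB hacc hpos (by simp [Complex.mem_slitPlane_iff]) (by simp) hu,
      neg_I_cpow, map_smul, smul_eq_mul] at h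
    linarith

lemma IsAccretive.isUnit {m : ℕ} {M : Matrix (Fin m) (Fin m) ℂ} (hM : IsAccretive M) :
    IsUnit M := by
  simpa using hM.avoidsNonpos 0

lemma mulVec_ne_zero_of_isometry {n k : ℕ} {S : Matrix (Fin n) (Fin k) ℂ} (hS : Sᴴ * S = 1)
    {v : Fin k → ℂ} (hv : v ≠ 0) : S *ᵥ v ≠ 0 := fun h => hv <| by
  rw [← one_mulVec v, ← hS, ← mulVec_mulVec, h, mulVec_zero]

lemma quadForm_conjTranspose_mul_mul {n k : ℕ} (S : Matrix (Fin n) (Fin k) ℂ)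
    (C : Matrix (Fin n) (Fin n) ℂ) (v : Fin k → ℂ) :
    quadForm v (Sᴴ * C * S) = quadForm (S *ᵥ v) C := by
  rw [quadForm_apply, quadForm_apply, star_mulVec, ← dotProduct_mulVec, mulVec_mulVec,
    mulVec_mulVec, Matrix.mul_assoc]

/-- Eigenvalues of a product of an accretive and a sectorial matrix. -/
lemma eigenvalue_mul_mem_sector {k : ℕ} {A N : Matrix (Fin k) (Fin k) ℂ} (hA : IsAccretive A)
    {b : ℝ} (hb : b ≤ Real.pi / 2) (hN : ∀ v, v ≠ 0 → 0 < (quadForm v N).re ∧ |(quadForm v N).arg| ≤ b)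
    {v : Fin k → ℂ} (hv : v ≠ 0) {x : ℂ} (hx : (A * N) *ᵥ v = x • v) :
    x ∈ Complex.slitPlane ∧ |x.arg| ≤ b + Real.pi / 2 := by
  have hdet : IsUnit A.det := (isUnit_iff_isUnit_det A).mp hA.isUnit
  set w := A⁻¹ *ᵥ v with hw
  have hvw : v = A *ᵥ w := by rw [hw, mulVec_mulVec, mul_nonsing_inv _ hdet, one_mulVec]
  have hw0 : w ≠ 0 := fun h => hv (by rw [hvw, h, mulVec_zero])
  have hNv : N *ᵥ v = x • w := by
    rw [hw, ← mulVec_smul, ← hx, mulVec_mulVec, ← mul_assoc, nonsing_inv_mul _ hdet, one_mul]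
  have h1 : quadForm v N = x * star (quadForm w A) := by
    rw [quadForm_apply, hNv, dotProduct_smul, smul_eq_mul, quadForm_apply, ← star_dotProduct, ← hvw]
  set q := star (quadForm w A) with hq
  have hq0 : 0 < q.re := hA w hw0
  have hq1 : q ≠ 0 := fun h => by rw [h, Complex.zero_re] at hq0; exact lt_irrefl _ hq0
  have h2 : x = quadForm v N * q⁻¹ := by rw [h1, mul_inv_cancel_right₀ hq1]
  have h3 : |q⁻¹.arg| < Real.pi / 2 := by
    rw [Complex.abs_arg_inv]
    exact Complex.abs_arg_lt_pi_div_two_iff.mpr (Or.inl hq0)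
  obtain ⟨h4, h5⟩ := hN v hv
  have h6 : quadForm v N ≠ 0 := fun h => by rw [h, Complex.zero_re] at h4; exact lt_irrefl _ h4
  obtain ⟨h7, h8⟩ := arg_mul_of_abs_lt h6 (inv_ne_zero hq1) (by linarith)
  rw [h2, h7]
  exact ⟨h8, (abs_add_le _ _).trans (by linarith)⟩

lemma exists_eigenvector_of_mem_roots {m : ℕ} {M : Matrix (Fin m) (Fin m) ℂ} {x : ℂ}
    (hx : x ∈ M.charpoly.roots) : ∃ v, v ≠ 0 ∧ M *ᵥ v = x • v := by
  have h := (Polynomial.mem_roots'.mp hx).2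
  rw [Polynomial.IsRoot.def, eval_charpoly] at h
  obtain ⟨v, hv, h'⟩ := exists_mulVec_eq_zero_iff.mpr h
  refine ⟨v, hv, ?_⟩
  rw [sub_mulVec, sub_eq_zero, scalar_apply, ← smul_one_eq_diagonal, smul_mulVec, one_mulVec] at h'
  exact h'.symm

lemma posDef_mpow_sandwich {n k : ℕ} {S : Matrix (Fin n) (Fin k) ℂ} (hS : Sᴴ * S = 1)
    {A : Matrix (Fin k) (Fin k) ℂ} (hA : A.PosDef) {B : Matrix (Fin n) (Fin n) ℂ} (hB : B.PosDef)
    (p q : ℝ) : (mpow A p * Sᴴ * mpow B q * S * mpow A p).PosDef := by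
  have hR := mpow_posDef hA p
  have hN : (Sᴴ * mpow B q * S).PosDef :=
    (mpow_posDef hB q).conjTranspose_mul_mul_same fun v w hvw => by
      by_contra hne
      refine mulVec_ne_zero_of_isometry hS (sub_ne_zero.mpr hne) ?_
      rw [mulVec_sub, sub_eq_zero]
      exact hvw
  have := hN.mul_mul_conjTranspose_same (vecMul_injective_of_isUnit hR.isAccretive.isUnit)
  rw [hR.1.eq] at this
  simpa only [Matrix.mul_assoc] using this

/-- The trace functional of the theorem along a positive definite family extends to a holomorphic
function with nonnegative real part on the right half-plane. -/
lemma exists_holomorphic_trace {n k : ℕ} (S : Matrix (Fin n) (Fin k) ℂ) (hS : Sᴴ * S = 1)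
    {α : ℝ} (hα : α ∈ Ico (1 / 2 : ℝ) 1)
    {A : ℂ → Matrix (Fin k) (Fin k) ℂ} (hA : DifferentiableOn ℂ A rightHalfPlane)
    (hAacc : ∀ u ∈ rightHalfPlane, IsAccretive (A u)) (hApos : ∀ x : ℝ, 0 < x → (A x).PosDef)
    {B : ℂ → Matrix (Fin n) (Fin n) ℂ} (hB : DifferentiableOn ℂ B rightHalfPlane)
    (hBacc : ∀ u ∈ rightHalfPlane, IsAccretive (B u)) (hBpos : ∀ x : ℝ, 0 < x → (B x).PosDef) :
    ∃ F : ℂ → ℂ, DifferentiableOn ℂ F rightHalfPlane ∧ (∀ u ∈ rightHalfPlane, 0 ≤ (F u).re) ∧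
      ∀ x : ℝ, 0 < x → F x = (mpow (mpow (A x) (1 / 2) * Sᴴ * mpow (B x) ((1 - α) / α) * S
          * mpow (A x) (1 / 2)) α).trace := by
  have hα0 : 0 < α := by linarith [hα.1]
  have hp : (1 - α) / α ∈ Ioc (0 : ℝ) 1 :=
    ⟨div_pos (by linarith [hα.2]) hα0, by rw [div_le_one hα0]; linarith [hα.1]⟩
  obtain ⟨C, hC, hCx, hCs⟩ := exists_holomorphic_mpow hp hB hBacc hBpos
  obtain ⟨ν, hfin, hν⟩ := exists_measure_unitInterval_rpow ⟨hα0, hα.2⟩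
  have hpi := Real.pi_pos
  have hb : (1 - α) / α * (Real.pi / 2) ≤ Real.pi / 2 :=
    mul_le_of_le_one_left (by positivity) hp.2
  have hN : ∀ u ∈ rightHalfPlane, ∀ v, v ≠ 0 → 0 < (quadForm v (Sᴴ * C u * S)).re ∧
      |(quadForm v (Sᴴ * C u * S)).arg| ≤ (1 - α) / α * (Real.pi / 2) := fun u hu v hv => by
    rw [quadForm_conjTranspose_mul_mul]
    exact hCs u hu _ (mulVec_ne_zero_of_isometry hS hv)
  have havoid : ∀ u ∈ rightHalfPlane, AvoidsNonpos (A u * (Sᴴ * C u * S)) := fun u hu =>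
    avoidsNonpos_of_eigenvalues fun v hv x hx =>
      (eigenvalue_mul_mem_sector (hAacc u hu) hb (hN u hu) hv hx).1
  have hNd : DifferentiableOn ℂ (fun u => Sᴴ * C u * S) rightHalfPlane := by
    have h := (LinearMap.toContinuousLinearMap
      (((mulRightLinearMap (Fin k) ℂ S).comp
        (mulLeftLinearMap (Fin n) ℂ Sᴴ)))).differentiable.comp_differentiableOn hC
    exact h
  refine ⟨fun u => (powIntegral ν (A u * (Sᴴ * C u * S))).trace, ?_, fun u hu => ?_, fun x hx => ?_⟩
  · exact (LinearMap.toContinuousLinearMap (traceLinearMap (Fin k) ℂ ℂ)).differentiable.comp_differentiableOn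
      (differentiableOn_powIntegral ν isOpen_rightHalfPlane (hA.mul hNd) havoid)
  · simp only
    rw [trace_powIntegral ν hν (havoid u hu), ← Complex.reCLM_apply, map_multiset_sum,
      Multiset.map_map]
    refine Multiset.sum_nonneg fun y hy => ?_
    obtain ⟨x, hx, rfl⟩ := Multiset.mem_map.mp hy
    obtain ⟨v, hv, hxv⟩ := exists_eigenvector_of_mem_roots hx
    have h1 := (eigenvalue_mul_mem_sector (hAacc u hu) hb (hN u hu) hv hxv).2
    have h2 : |x.arg * α| ≤ Real.pi / 2 := by
      rw [abs_mul, abs_of_pos hα0]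
      calc |x.arg| * α ≤ ((1 - α) / α * (Real.pi / 2) + Real.pi / 2) * α := by gcongr
        _ = _ := by field_simp; ring
    simp only [Function.comp_apply, Complex.reCLM_apply]
    rw [Complex.cpow_ofReal_re]
    exact mul_nonneg (by positivity) (Real.cos_nonneg_of_mem_Icc (abs_le.mp h2))
  · simp only
    rw [hCx x hx]
    set R := mpow (A x) (1 / 2)
    have hR : R.PosDef := mpow_posDef (hApos x hx) _
    have hRdet : IsUnit R.det := (isUnit_iff_isUnit_det R).mp hR.isAccretive.isUnit
    have hX : (R * (Sᴴ * mpow (B x) ((1 - α) / α) * S) * R).PosDef := by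
      have := posDef_mpow_sandwich hS (hApos x hx) (hBpos x hx) (1 / 2) ((1 - α) / α)
      simpa only [Matrix.mul_assoc] using this
    have h1 : A x * (Sᴴ * mpow (B x) ((1 - α) / α) * S)
        = R * (R * (Sᴴ * mpow (B x) ((1 - α) / α) * S) * R) * R⁻¹ := by
      conv_lhs => rw [← mpow_half_mul_self (hApos x hx)]
      rw [mul_assoc R _ R⁻¹, mul_assoc (R * _) R R⁻¹, mul_nonsing_inv _ hRdet, mul_one, mul_assoc]
    rw [h1, powIntegral_conj ν hX.isAccretive.avoidsNonpos (mul_nonsing_inv _ hRdet),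
      trace_mul_cycle, nonsing_inv_mul _ hRdet, one_mul, powIntegral_posDef ν hν hX]
    simp only [Matrix.mul_assoc]

lemma quadForm_posDef_im {m : ℕ} {P : Matrix (Fin m) (Fin m) ℂ} (hP : P.PosDef)
    (v : Fin m → ℂ) : (quadForm v P).im = 0 :=
  (RCLike.nonneg_iff.mp (hP.posSemidef.dotProduct_mulVec_nonneg v)).2

lemma pencil_spec {m : ℕ} {P Q : Matrix (Fin m) (Fin m) ℂ} (hP : P.PosDef) (hQ : Q.PosDef) :
    DifferentiableOn ℂ (fun u : ℂ => u • P + u⁻¹ • Q) rightHalfPlane ∧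
      (∀ u ∈ rightHalfPlane, IsAccretive (u • P + u⁻¹ • Q)) ∧
      ∀ x : ℝ, 0 < x → ((x : ℂ) • P + (x : ℂ)⁻¹ • Q).PosDef := by
  have hne : ∀ u ∈ rightHalfPlane, u ≠ 0 := fun u hu h => by
    rw [h] at hu
    exact lt_irrefl (0 : ℝ) hu
  refine ⟨?_, fun u hu v hv => ?_, fun x hx => ?_⟩
  · exact (differentiableOn_id.smul_const P).add
      ((differentiableOn_id.inv fun u hu => hne u hu).smul_const Q)
  · have hu' : 0 < (u⁻¹).re := by
      rw [Complex.inv_re]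
      exact div_pos hu (Complex.normSq_pos.mpr (hne u hu))
    rw [map_add, map_smul, map_smul, smul_eq_mul, smul_eq_mul, Complex.add_re, Complex.mul_re,
      Complex.mul_re, quadForm_posDef_im hP, quadForm_posDef_im hQ, mul_zero, mul_zero, sub_zero,
      sub_zero]
    exact add_pos (mul_pos hu (hP.isAccretive v hv)) (mul_pos hu' (hQ.isAccretive v hv))
  · have hx' : (0 : ℂ) < x := by exact_mod_cast hx
    have hx'' : (0 : ℂ) < (x : ℂ)⁻¹ := by
      rw [← Complex.ofReal_inv]
      exact_mod_cast inv_pos.mpr hx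
    exact (hP.smul hx').add (hQ.smul hx'')

lemma pencil_eq {m : ℕ} (G H : Matrix (Fin m) (Fin m) ℂ) {x : ℝ} (hx : 0 < x) :
    (x : ℂ) • (G + H) + (x : ℂ)⁻¹ • (G - H)
      = (x + x⁻¹) • (G + ((x ^ 2 - 1) / (x ^ 2 + 1)) • H) := by
  have h1 : (x + x⁻¹) * ((x ^ 2 - 1) / (x ^ 2 + 1)) = x - x⁻¹ := by field_simp
  rw [smul_add (x + x⁻¹), smul_smul, h1, ← Complex.ofReal_inv, Complex.coe_smul, Complex.coe_smul]
  module

/-- The function of the theorem, reparametrized and multiplied by a weight, is the real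
part of a holomorphic function on the right half-plane with nonnegative real part. -/
lemma exists_holomorphic_extension {n k : ℕ} (S : Matrix (Fin n) (Fin k) ℂ) (hS : Sᴴ * S = 1)
    {α : ℝ} (hα : α ∈ Ico (1 / 2 : ℝ) 1)
    (G H : Matrix (Fin k) (Fin k) ℂ) (Z K : Matrix (Fin n) (Fin n) ℂ)
    (hGHp : (G + H).PosDef) (hGHm : (G - H).PosDef)
    (hZKp : (Z + K).PosDef) (hZKm : (Z - K).PosDef) :
    ∃ F : ℂ → ℂ, DifferentiableOn ℂ F rightHalfPlane ∧ (∀ u ∈ rightHalfPlane, 0 ≤ (F u).re) ∧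
      ∀ x : ℝ, 0 < x → (F x).re = (x + x⁻¹) * (fun t : ℝ =>
        ((mpow (mpow (G + t • H) (1 / 2) * Sᴴ * mpow (Z + t • K) ((1 - α) / α) * S
          * mpow (G + t • H) (1 / 2)) α).trace).re) ((x ^ 2 - 1) / (x ^ 2 + 1)) := by
  obtain ⟨hA, hAacc, hApos⟩ := pencil_spec hGHp hGHm
  obtain ⟨hB, hBacc, hBpos⟩ := pencil_spec hZKp hZKm
  obtain ⟨F, hF, hFre, hFx⟩ := exists_holomorphic_trace S hS hα hA hAacc hApos hB hBacc hBpos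
  refine ⟨F, hF, hFre, fun x hx => ?_⟩
  have hα0 : 0 < α := by linarith [hα.1]
  have hc : 0 < x + x⁻¹ := by positivity
  have hG := hApos x hx
  have hZ := hBpos x hx
  rw [hFx x hx]
  simp only
  rw [pencil_eq G H hx] at hG ⊢
  rw [pencil_eq Z K hx] at hZ ⊢
  set c := x + x⁻¹
  set t := (x ^ 2 - 1) / (x ^ 2 + 1)
  have hunscale : ∀ {m : ℕ} {X : Matrix (Fin m) (Fin m) ℂ}, (c • X).PosDef → X.PosDef :=
    fun {m X} hX => by
      have := hX.smul (inv_pos.mpr hc)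
      rwa [smul_smul, inv_mul_cancel₀ hc.ne', one_smul] at this
  replace hG := hunscale hG
  replace hZ := hunscale hZ
  have hexp : ((c ^ (1 / 2 : ℝ) * (c ^ ((1 - α) / α) * c ^ (1 / 2 : ℝ))) ^ α : ℝ) = c := by
    rw [← Real.rpow_add hc, ← Real.rpow_add hc, ← Real.rpow_mul hc.le]
    convert Real.rpow_one c using 2
    field_simp
    ring
  have hX := posDef_mpow_sandwich hS hG hZ (1 / 2) ((1 - α) / α)
  have hpos : 0 < c ^ (1 / 2 : ℝ) * (c ^ ((1 - α) / α) * c ^ (1 / 2 : ℝ)) := by positivity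
  have h1 : mpow (c • (G + t • H)) (1 / 2) * Sᴴ * mpow (c • (Z + t • K)) ((1 - α) / α) * S
      * mpow (c • (G + t • H)) (1 / 2)
      = (c ^ (1 / 2 : ℝ) * (c ^ ((1 - α) / α) * c ^ (1 / 2 : ℝ))) •
        (mpow (G + t • H) (1 / 2) * Sᴴ * mpow (Z + t • K) ((1 - α) / α) * S
          * mpow (G + t • H) (1 / 2)) := by
    rw [mpow_smul hG hc, mpow_smul hZ hc]
    simp only [Matrix.smul_mul, Matrix.mul_smul, smul_smul]
  rw [h1, mpow_smul hX hpos, hexp, trace_smul, Complex.real_smul, Complex.re_ofReal_mul]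

lemma continuousOn_poissonKernel_sphere {w : ℂ} (hw : ‖w‖ < 1) :
    ContinuousOn (poissonKernel 0 w) (Metric.sphere 0 1) := by
  intro z hz
  have hz1 : ‖z‖ = 1 := by simpa using hz
  have hne : ‖z - w‖ ^ 2 ≠ 0 := by
    have : z ≠ w := by rintro rfl; linarith
    simpa [sub_eq_zero] using this
  have : poissonKernel 0 w = fun z => (‖z‖ ^ 2 - ‖w‖ ^ 2) / ‖z - w‖ ^ 2 := by
    ext z
    simp [poissonKernel_def]
  rw [this]
  refine ContinuousAt.continuousWithinAt (ContinuousAt.div ?_ ?_ hne) <;> fun_prop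

/-- A finite combination of values of a holomorphic function with nonnegative real part
inherits the sign of the corresponding combination of Poisson kernels. -/
lemma sum_re_nonneg_of_poissonKernel {ι : Type*} [Fintype ι] {f : ℂ → ℂ}
    (hf : DiffContOnCl ℂ f (Metric.ball 0 1)) (hre : ∀ z : ℂ, ‖z‖ = 1 → 0 ≤ (f z).re)
    (w : ι → ℂ) (hw : ∀ i, ‖w i‖ < 1) (b : ι → ℝ)
    (hb : ∀ z : ℂ, ‖z‖ = 1 → 0 ≤ ∑ i, b i * poissonKernel 0 (w i) z) :
    0 ≤ ∑ i, b i * (f (w i)).re := by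
  have hcont : ContinuousOn f (Metric.sphere 0 1) := by
    refine hf.continuousOn.mono ?_
    rw [closure_ball 0 one_ne_zero]
    exact Metric.sphere_subset_closedBall
  have hint : ∀ i, CircleIntegrable (b i • (poissonKernel 0 (w i) • f)) 0 1 := fun i =>
    ContinuousOn.circleIntegrable zero_le_one
      (((continuousOn_poissonKernel_sphere (hw i)).smul hcont).const_smul (b i))
  have hsum : Real.circleAverage (∑ i, b i • (poissonKernel 0 (w i) • f)) 0 1
      = ∑ i, b i • f (w i) := by
    rw [Real.circleAverage_sum fun i _ => hint i]
    refine Finset.sum_congr rfl fun i _ => ?_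
    rw [Real.circleAverage_smul, hf.circleAverage_poissonKernel_smul (by simpa using hw i)]
  have hre_sum := Complex.reCLM.circleAverage_comp_comm
    (CircleIntegrable.sum Finset.univ fun i _ => hint i)
  rw [hsum] at hre_sum
  have : ∑ i, b i * (f (w i)).re = Complex.reCLM (∑ i, b i • f (w i)) := by
    simp
  rw [this, ← hre_sum]
  refine Real.circleAverage_nonneg_of_nonneg fun z hz => ?_
  have hz1 : ‖z‖ = 1 := by simpa using hz
  have : (Complex.reCLM ∘ ∑ i, b i • (poissonKernel 0 (w i) • f)) z
      = (∑ i, b i * poissonKernel 0 (w i) z) * (f z).re := by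
    simp [Finset.sum_apply, Finset.sum_mul, mul_assoc]
  rw [this]
  exact mul_nonneg (hb z hz1) (hre z hz1)

/-- The Cayley parameter `w` of a point `t = 2w / (1 + w²)` of `(-1, 1)`. -/
lemma exists_cayley_param {t : ℝ} (ht : t ∈ Ioo (-1 : ℝ) 1) :
    ∃ w : ℝ, w ∈ Ioo (-1 : ℝ) 1 ∧ t * (1 + w ^ 2) = 2 * w := by
  have hs : 0 < 1 - t ^ 2 := by nlinarith [ht.1, ht.2]
  set s := √(1 - t ^ 2)
  have hs2 : s ^ 2 = 1 - t ^ 2 := Real.sq_sqrt hs.le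
  have hs0 : 0 < s := Real.sqrt_pos.mpr hs
  refine ⟨t / (1 + s), ⟨?_, ?_⟩, ?_⟩
  · rw [lt_div_iff₀ (by positivity)]; linarith [ht.1]
  · rw [div_lt_iff₀ (by positivity)]; linarith [ht.2]
  · field_simp
    linear_combination t * hs2

/-- Functions on `(-1, 1)` coming from a holomorphic function of positive real part on the
right half-plane are, tested against finite signed measures, nonnegative mixtures of the
kernels `t ↦ (1 - t²) / (1 - c t)`. -/
lemma sum_nonneg_of_kernel {ι : Type*} [Fintype ι] {F : ℂ → ℂ} {ψ : ℝ → ℝ}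
    (hF : DifferentiableOn ℂ F rightHalfPlane) (hre : ∀ u ∈ rightHalfPlane, 0 ≤ (F u).re)
    (hψ : ∀ x : ℝ, 0 < x → (F x).re = (x + x⁻¹) * ψ ((x ^ 2 - 1) / (x ^ 2 + 1)))
    (t : ι → ℝ) (ht : ∀ i, t i ∈ Ioo (-1 : ℝ) 1) (a : ι → ℝ)
    (ha : ∀ c ∈ Icc (-1 : ℝ) 1, 0 ≤ ∑ i, a i * ((1 - t i ^ 2) / (1 - c * t i))) :
    0 ≤ ∑ i, a i * ψ (t i) := by
  choose w hw hwt using fun i => exists_cayley_param (ht i)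
  have hcayley : ∀ z : ℂ, ‖z‖ < 1 → (1 + z) / (1 - z) ∈ rightHalfPlane := by
    intro z hz
    have hz2 : Complex.normSq z < 1 := by
      rw [Complex.normSq_eq_norm_sq]; nlinarith [norm_nonneg z]
    have hne : 1 - z ≠ 0 := by
      rw [sub_ne_zero]; rintro rfl; simp at hz
    have hpos := Complex.normSq_pos.mpr hne
    change 0 < ((1 + z) / (1 - z)).re
    rw [Complex.div_re, ← add_div]
    refine div_pos ?_ hpos
    simp [Complex.normSq_apply] at hz2 ⊢
    nlinarith
  have hΦ : DifferentiableOn ℂ (fun z : ℂ => F ((1 + z) / (1 - z))) (Metric.ball 0 1) := by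
    refine hF.comp ?_ fun z hz => hcayley z (by simpa using hz)
    intro z hz
    have hne : 1 - z ≠ 0 := by
      rw [sub_ne_zero]; rintro rfl; simp at hz
    exact (DifferentiableAt.div (by fun_prop) (by fun_prop) hne).differentiableWithinAt
  set Φ : ℂ → ℂ := fun z : ℂ => F ((1 + z) / (1 - z)) with hΦdef
  have hw1 : ∀ i, ‖(w i : ℂ)‖ < 1 := fun i => by
    rw [Complex.norm_real, Real.norm_eq_abs]; exact abs_lt.mpr (hw i)
  have hwsq : ∀ i, 0 < 1 - w i ^ 2 := fun i => by nlinarith [(hw i).1, (hw i).2]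
  set b : ι → ℝ := fun i => a i * ((1 - w i ^ 2) / (2 * (1 + w i ^ 2)))
  have hval : ∀ i, b i * (Φ (w i)).re = a i * ψ (t i) := by
    intro i
    have hm : 0 < 1 - w i := by linarith [(hw i).2]
    have hp : 0 < 1 + w i := by linarith [(hw i).1]
    have hu : (1 + (w i : ℂ)) / (1 - w i) = (((1 + w i) / (1 - w i) : ℝ) : ℂ) := by push_cast; rfl
    have hti : t i = 2 * w i / (1 + w i ^ 2) := by
      rw [eq_div_iff (by positivity), hwt i]
    have harg : (((1 + w i) / (1 - w i)) ^ 2 - 1) / (((1 + w i) / (1 - w i)) ^ 2 + 1) = t i := by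
      rw [hti]
      field_simp
      ring
    rw [hΦdef]
    simp only
    rw [hu, hψ _ (div_pos hp hm), harg]
    have h := (hwsq i).ne'
    have : (1 + w i) / (1 - w i) + ((1 + w i) / (1 - w i))⁻¹
        = 2 * (1 + w i ^ 2) / (1 - w i ^ 2) := by
      have : 1 - w i ^ 2 = (1 - w i) * (1 + w i) := by ring
      rw [this]
      field_simp
      ring
    rw [this]
    simp only [b]
    field_simp
  have hker : ∀ z : ℂ, ‖z‖ = 1 → 0 ≤ ∑ i, b i * poissonKernel 0 (w i) z := by
    intro z hz
    have hz2 : z.re ^ 2 + z.im ^ 2 = 1 := by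
      have := Complex.sq_norm z
      rw [hz, Complex.normSq_apply] at this
      linarith
    have hc : z.re ∈ Icc (-1 : ℝ) 1 := ⟨by nlinarith [sq_nonneg z.im], by nlinarith [sq_nonneg z.im]⟩
    have : ∀ i, b i * poissonKernel 0 (w i) z
        = (1 / 2) * (a i * ((1 - t i ^ 2) / (1 - z.re * t i))) := by
      intro i
      have hti : t i = 2 * w i / (1 + w i ^ 2) := by
        rw [eq_div_iff (by positivity), hwt i]
      have hn : ‖z - w i‖ ^ 2 = 1 + w i ^ 2 - 2 * z.re * w i := by
        rw [Complex.sq_norm, Complex.normSq_apply]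
        simp
        nlinarith
      have hpos : 0 < 1 + w i ^ 2 - 2 * z.re * w i := by
        rw [← hn]
        have : z ≠ w i := by rintro rfl; linarith [hw1 i]
        have := norm_pos_iff.mpr (sub_ne_zero.mpr this)
        positivity
      have hq : 0 < 1 + w i ^ 2 := by positivity
      have h1 : 1 - z.re * t i = (1 + w i ^ 2 - 2 * z.re * w i) / (1 + w i ^ 2) := by
        rw [hti]; field_simp
      have h2 : 1 - t i ^ 2 = ((1 - w i ^ 2) / (1 + w i ^ 2)) ^ 2 := by
        rw [hti]; field_simp; ring
      rw [poissonKernel_def, sub_zero, sub_zero, hn, hz, h1, h2]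
      simp only [b, Complex.norm_real, Real.norm_eq_abs, sq_abs]
      field_simp
    rw [Finset.sum_congr rfl fun i _ => this i, ← Finset.mul_sum]
    exact mul_nonneg (by norm_num) (ha z.re hc)
  have hr : ∀ r ∈ Ioo (0 : ℝ) 1, 0 ≤ ∑ i, b i * (Φ (r * w i)).re := by
    intro r hr
    have hmaps : ∀ z ∈ Metric.closedBall (0 : ℂ) 1, (r : ℂ) * z ∈ Metric.ball (0 : ℂ) 1 := by
      intro z hz
      have : ‖z‖ ≤ 1 := by simpa using hz
      rw [mem_ball_zero_iff, norm_mul, Complex.norm_real, Real.norm_eq_abs, abs_of_pos hr.1]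
      nlinarith [hr.1, hr.2, norm_nonneg z]
    refine sum_re_nonneg_of_poissonKernel (f := fun z => Φ (r * z)) ?_ ?_ (fun i => (w i : ℂ)) hw1 b
      hker
    · have hd : DifferentiableOn ℂ (fun z : ℂ => Φ (r * z)) (closure (Metric.ball 0 1)) := by
        rw [closure_ball 0 one_ne_zero]
        exact hΦ.comp (by fun_prop) hmaps
      exact hd.diffContOnCl
    · intro z hz
      exact hre _ (hcayley _ (by simpa using hmaps z (by simp [hz])))
  have hlim : Tendsto (fun r : ℝ => ∑ i, b i * (Φ (r * w i)).re) (𝓝[<] 1)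
      (𝓝 (∑ i, b i * (Φ (w i)).re)) := by
    refine tendsto_finsetSum _ fun i _ => Tendsto.const_mul _ ?_
    have hcont : ContinuousAt Φ (w i) :=
      (hΦ.differentiableAt (Metric.isOpen_ball.mem_nhds (by simpa using hw1 i))).continuousAt
    have h1 : Tendsto (fun r : ℝ => (r : ℂ) * w i) (𝓝[<] 1) (𝓝 (w i)) := by
      have : ContinuousAt (fun r : ℝ => (r : ℂ) * w i) 1 := by fun_prop
      simpa using this.tendsto.mono_left nhdsWithin_le_nhds
    exact (Complex.continuous_re.tendsto _).comp (hcont.tendsto.comp h1)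
  rw [← Finset.sum_congr rfl fun i _ => hval i]
  exact ge_of_tendsto hlim (eventually_of_mem (Ioo_mem_nhdsLT one_pos) hr)
end

section
open Set

section
open scoped MatrixOrder

lemma posDef_cfc_iff {d : ℕ} {A : Matrix (Fin d) (Fin d) ℂ} (hA : A.IsHermitian) (f : ℝ → ℝ) :
    (cfc f A).PosDef ↔ ∀ x ∈ spectrum ℝ A, 0 < f x := by
  rw [← isStrictlyPositive_iff_posDef,
    cfc_isStrictlyPositive_iff f A (Matrix.finite_real_spectrum.continuousOn f)
      hA.isSelfAdjoint]

end

lemma spectrum_subset_Ioo_iff {d : ℕ} {A : Matrix (Fin d) (Fin d) ℂ} (hA : A.IsHermitian) :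
    spectrum ℝ A ⊆ Ioo (-1) 1 ↔ (1 + A).PosDef ∧ (1 - A).PosDef := by
  have h1 : 1 + A = cfc (fun x : ℝ => 1 + x) A := by
    rw [cfc_const_add (R := ℝ) 1 (fun x => x) A (by fun_prop) hA.isSelfAdjoint,
      cfc_id' ℝ A hA.isSelfAdjoint, map_one]
  have h2 : 1 - A = cfc (fun x : ℝ => 1 - x) A := by
    rw [cfc_sub (fun _ : ℝ => 1) (fun x => x) A, cfc_const_one ℝ A hA.isSelfAdjoint,
      cfc_id' ℝ A hA.isSelfAdjoint]
  rw [h1, h2, posDef_cfc_iff hA, posDef_cfc_iff hA, ← forall₂_and]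
  refine forall₂_congr fun x _ => ?_
  rw [mem_Ioo]
  constructor <;> rintro ⟨h, h'⟩ <;> constructor <;> linarith

lemma convexCombo_posDef {d : ℕ} {X Y : Matrix (Fin d) (Fin d) ℂ} (hX : X.PosDef) (hY : Y.PosDef)
    {l : ℝ} (hl0 : 0 ≤ l) (hl1 : l ≤ 1) : (l • X + (1 - l) • Y).PosDef := by
  rcases hl0.eq_or_lt with rfl | hl
  · simpa using hY
  · exact (hX.smul hl).add_posSemidef (hY.posSemidef.smul (sub_nonneg.mpr hl1))

lemma spectrum_convexCombo_subset {d : ℕ} {X Y : Matrix (Fin d) (Fin d) ℂ} (hX : X.IsHermitian)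
    (hY : Y.IsHermitian) (hM : ∀ l : ℝ, (l • X + (1 - l) • Y).IsHermitian)
    (hXs : spectrum ℝ X ⊆ Ioo (-1) 1) (hYs : spectrum ℝ Y ⊆ Ioo (-1) 1)
    {l : ℝ} (hl0 : 0 ≤ l) (hl1 : l ≤ 1) : spectrum ℝ (l • X + (1 - l) • Y) ⊆ Ioo (-1) 1 := by
  rw [spectrum_subset_Ioo_iff hX] at hXs
  rw [spectrum_subset_Ioo_iff hY] at hYs
  rw [spectrum_subset_Ioo_iff (hM l)]
  refine ⟨?_, ?_⟩
  · convert convexCombo_posDef hXs.1 hYs.1 hl0 hl1 using 1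
    module
  · convert convexCombo_posDef hXs.2 hYs.2 hl0 hl1 using 1
    module

/-- The coordinates of a vector in the eigenbasis of a Hermitian matrix. -/
noncomputable def eigenCoord {d : ℕ} {A : Matrix (Fin d) (Fin d) ℂ} (hA : A.IsHermitian)
    (v : Fin d → ℂ) : Fin d → ℂ :=
  star (hA.eigenvectorUnitary : Matrix (Fin d) (Fin d) ℂ) *ᵥ v

lemma eigenCoord_surjective {d : ℕ} {A : Matrix (Fin d) (Fin d) ℂ} (hA : A.IsHermitian)
    (w : Fin d → ℂ) : ∃ v, eigenCoord hA v = w :=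
  ⟨(hA.eigenvectorUnitary : Matrix (Fin d) (Fin d) ℂ) *ᵥ w, by
    rw [eigenCoord, mulVec_mulVec, Unitary.coe_star_mul_self, one_mulVec]⟩

lemma star_dotProduct_cfc_mulVec {d : ℕ} {A : Matrix (Fin d) (Fin d) ℂ} (hA : A.IsHermitian)
    (f : ℝ → ℝ) (s v : Fin d → ℂ) :
    star s ⬝ᵥ (cfc f A) *ᵥ v
      = ∑ i, star (eigenCoord hA s i) * (f (hA.eigenvalues i) * eigenCoord hA v i) := by
  have hs : star (eigenCoord hA s)
      = star s ᵥ* (hA.eigenvectorUnitary : Matrix (Fin d) (Fin d) ℂ) := by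
    rw [eigenCoord, star_mulVec, star_eq_conjTranspose, conjTranspose_conjTranspose]
  rw [hA.cfc_eq, IsHermitian.cfc, Unitary.conjStarAlgAut_apply, ← mulVec_mulVec, ← mulVec_mulVec,
    dotProduct_mulVec, ← hs, dotProduct]
  refine Finset.sum_congr rfl fun i _ => ?_
  rw [mulVec_diagonal]
  rfl

lemma re_star_dotProduct_cfc_mulVec {d : ℕ} {A : Matrix (Fin d) (Fin d) ℂ} (hA : A.IsHermitian)
    (f : ℝ → ℝ) (v : Fin d → ℂ) :
    (star v ⬝ᵥ (cfc f A) *ᵥ v).re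
      = ∑ i, Complex.normSq (eigenCoord hA v i) * f (hA.eigenvalues i) := by
  rw [star_dotProduct_cfc_mulVec hA, Complex.re_sum]
  refine Finset.sum_congr rfl fun i _ => ?_
  simp [Complex.normSq_apply]
  ring

/-- The quadratic functional whose infimum over `s` is the quadratic form at `v` of the kernel
`t ↦ (1 - t²) / (1 - c t)` applied to `A`; it is affine in `A`. -/
noncomputable def kernelForm {d : ℕ} (c : ℝ) (s v : Fin d → ℂ) (A : Matrix (Fin d) (Fin d) ℂ) :
    ℝ :=
  (star v ⬝ᵥ v).re + c * (star v ⬝ᵥ A *ᵥ v).re - (1 - c ^ 2) * (2 * (star s ⬝ᵥ A *ᵥ v).re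
    - (star s ⬝ᵥ s).re + c * (star s ⬝ᵥ A *ᵥ s).re)

lemma kernelForm_convexCombo {d : ℕ} (c : ℝ) (s v : Fin d → ℂ) (X Y : Matrix (Fin d) (Fin d) ℂ)
    (l : ℝ) : kernelForm c s v (l • X + (1 - l) • Y)
      = l * kernelForm c s v X + (1 - l) * kernelForm c s v Y := by
  simp only [kernelForm, add_mulVec, smul_mulVec, dotProduct_add, dotProduct_smul, Complex.add_re,
    Complex.smul_re, smul_eq_mul]
  ring

lemma kernelForm_eq_sum {d : ℕ} (c : ℝ) (s v : Fin d → ℂ) {A : Matrix (Fin d) (Fin d) ℂ}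
    (hA : A.IsHermitian) : kernelForm c s v A
      = ∑ i, (Complex.normSq (eigenCoord hA v i) * (1 + c * hA.eigenvalues i)
        - (1 - c ^ 2) * (2 * hA.eigenvalues i * (star (eigenCoord hA s i) * eigenCoord hA v i).re
          - Complex.normSq (eigenCoord hA s i) * (1 - c * hA.eigenvalues i))) := by
  have h1 : ∀ s v : Fin d → ℂ, star s ⬝ᵥ v = ∑ i, star (eigenCoord hA s i) * eigenCoord hA v i := by
    intro s v
    have := star_dotProduct_cfc_mulVec hA (fun _ => 1) s v
    rw [cfc_const_one ℝ A hA.isSelfAdjoint, one_mulVec] at this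
    simpa using this
  have h2 : ∀ s v : Fin d → ℂ, star s ⬝ᵥ A *ᵥ v
      = ∑ i, star (eigenCoord hA s i) * (hA.eigenvalues i * eigenCoord hA v i) := by
    intro s v
    have := star_dotProduct_cfc_mulVec hA (fun x => x) s v
    rwa [cfc_id' ℝ A hA.isSelfAdjoint] at this
  simp only [kernelForm, h2]
  simp only [h1, Complex.re_sum, Finset.mul_sum, ← Finset.sum_add_distrib,
    ← Finset.sum_sub_distrib]
  refine Finset.sum_congr rfl fun i _ => ?_
  simp [Complex.normSq_apply]
  ring

lemma kernel_denom_pos {c t : ℝ} (hc : c ∈ Icc (-1 : ℝ) 1) (ht : t ∈ Ioo (-1 : ℝ) 1) :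
    0 < 1 - c * t := by
  obtain ⟨⟨hc1, hc2⟩, ht1, ht2⟩ := And.intro hc ht
  rcases le_total 0 c with h | h <;> nlinarith

lemma re_cfc_kernel_le_kernelForm {d : ℕ} {c : ℝ} (hc : c ∈ Icc (-1 : ℝ) 1) (s v : Fin d → ℂ)
    {A : Matrix (Fin d) (Fin d) ℂ} (hA : A.IsHermitian) (hAs : spectrum ℝ A ⊆ Ioo (-1) 1) :
    (star v ⬝ᵥ (cfc (fun t : ℝ => (1 - t ^ 2) / (1 - c * t)) A) *ᵥ v).re
      ≤ kernelForm c s v A := by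
  rw [re_star_dotProduct_cfc_mulVec hA, kernelForm_eq_sum c s v hA]
  refine Finset.sum_le_sum fun i _ => ?_
  have ht := hAs (hA.eigenvalues_mem_spectrum_real i)
  generalize hA.eigenvalues i = t at ht
  have hp := kernel_denom_pos hc ht
  have hc2 : 0 ≤ 1 - c ^ 2 := by nlinarith [hc.1, hc.2]
  generalize eigenCoord hA s i = σ
  generalize eigenCoord hA v i = ν
  rw [← sub_nonneg]
  have : Complex.normSq ν * (1 + c * t) - (1 - c ^ 2) * (2 * t * (star σ * ν).re
      - Complex.normSq σ * (1 - c * t)) - Complex.normSq ν * ((1 - t ^ 2) / (1 - c * t))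
      = (1 - c ^ 2) / (1 - c * t) * Complex.normSq ((1 - c * t : ℝ) * σ - (t : ℝ) * ν) := by
    simp [Complex.normSq_apply]
    field_simp
    ring
  rw [this]
  exact mul_nonneg (div_nonneg hc2 hp.le) (Complex.normSq_nonneg _)

lemma exists_kernelForm_eq {d : ℕ} {c : ℝ} (hc : c ∈ Icc (-1 : ℝ) 1) (v : Fin d → ℂ)
    {A : Matrix (Fin d) (Fin d) ℂ} (hA : A.IsHermitian) (hAs : spectrum ℝ A ⊆ Ioo (-1) 1) :
    ∃ s, kernelForm c s v A
      = (star v ⬝ᵥ (cfc (fun t : ℝ => (1 - t ^ 2) / (1 - c * t)) A) *ᵥ v).re := by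
  obtain ⟨s, hs⟩ := eigenCoord_surjective hA fun i =>
    ((hA.eigenvalues i / (1 - c * hA.eigenvalues i) : ℝ) : ℂ) * eigenCoord hA v i
  refine ⟨s, ?_⟩
  rw [re_star_dotProduct_cfc_mulVec hA, kernelForm_eq_sum c s v hA]
  refine Finset.sum_congr rfl fun i _ => ?_
  rw [congrFun hs i]
  have hp := kernel_denom_pos hc (hAs (hA.eigenvalues_mem_spectrum_real i))
  generalize hA.eigenvalues i = t at hp
  generalize eigenCoord hA v i = ν
  have h1 : (star (((t / (1 - c * t) : ℝ) : ℂ) * ν) * ν).re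
      = t / (1 - c * t) * Complex.normSq ν := by
    simp only [star_mul', Complex.star_def, Complex.conj_ofReal, mul_assoc, Complex.re_ofReal_mul]
    simp [Complex.normSq_apply]
  rw [h1, Complex.normSq_mul, Complex.normSq_ofReal]
  field_simp
  ring

/-- The defect of operator concavity, tested at a vector, is a finite combination of values of
the function with points and weights that do not depend on the function. -/
lemma exists_weights_concavity_defect {d : ℕ} {X Y M : Matrix (Fin d) (Fin d) ℂ}
    (hX : X.IsHermitian) (hY : Y.IsHermitian) (hM : M.IsHermitian) {J : Set ℝ}
    (hXs : spectrum ℝ X ⊆ J) (hYs : spectrum ℝ Y ⊆ J) (hMs : spectrum ℝ M ⊆ J)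
    (l : ℝ) (v : Fin d → ℂ) :
    ∃ t a : Fin d ⊕ Fin d ⊕ Fin d → ℝ, (∀ i, t i ∈ J) ∧ ∀ f : ℝ → ℝ,
      (star v ⬝ᵥ (cfc f M - (l • cfc f X + (1 - l) • cfc f Y)) *ᵥ v).re
        = ∑ i, a i * f (t i) := by
  refine ⟨Sum.elim hM.eigenvalues (Sum.elim hX.eigenvalues hY.eigenvalues),
    Sum.elim (fun i => Complex.normSq (eigenCoord hM v i))
      (Sum.elim (fun i => -(l * Complex.normSq (eigenCoord hX v i)))
        fun i => -((1 - l) * Complex.normSq (eigenCoord hY v i))), ?_, fun f => ?_⟩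
  · rintro (i | i | i)
    · exact hMs (hM.eigenvalues_mem_spectrum_real i)
    · exact hXs (hX.eigenvalues_mem_spectrum_real i)
    · exact hYs (hY.eigenvalues_mem_spectrum_real i)
  · simp only [sub_mulVec, add_mulVec, smul_mulVec, dotProduct_sub, dotProduct_add,
      dotProduct_smul, Complex.sub_re, Complex.add_re, Complex.smul_re, smul_eq_mul,
      re_star_dotProduct_cfc_mulVec hM, re_star_dotProduct_cfc_mulVec hX,
      re_star_dotProduct_cfc_mulVec hY, Fintype.sum_sum_type, Sum.elim_inl, Sum.elim_inr,
      neg_mul, Finset.sum_neg_distrib, mul_assoc, ← Finset.mul_sum]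
    ring

lemma operatorConcaveOn_of_kernel {ψ : ℝ → ℝ}
    (h : ∀ (ι : Type) [Fintype ι] (t a : ι → ℝ), (∀ i, t i ∈ Ioo (-1 : ℝ) 1) →
      (∀ c ∈ Icc (-1 : ℝ) 1, 0 ≤ ∑ i, a i * ((1 - t i ^ 2) / (1 - c * t i))) →
      0 ≤ ∑ i, a i * ψ (t i)) :
    OperatorConcaveOn ψ (Ioo (-1) 1) := by
  intro d X Y hX hY hXs hYs l hl0 hl1
  have hherm : ∀ {A B : Matrix (Fin d) (Fin d) ℂ}, A.IsHermitian → B.IsHermitian → ∀ l : ℝ,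
      (l • A + (1 - l) • B).IsHermitian := fun hA hB l =>
    (hA.smul (IsSelfAdjoint.all l)).add (hB.smul (IsSelfAdjoint.all (1 - l)))
  have hM := hherm hX hY l
  have hMs := spectrum_convexCombo_subset hX hY (hherm hX hY) hXs hYs hl0 hl1
  have hcfc : ∀ A : Matrix (Fin d) (Fin d) ℂ, (cfc ψ A).IsHermitian := fun A => cfc_predicate ψ A
  have hD := (hcfc (l • X + (1 - l) • Y)).sub (hherm (hcfc X) (hcfc Y) l)
  refine PosSemidef.of_dotProduct_mulVec_nonneg hD fun v => ?_
  obtain ⟨t, a, ht, hta⟩ := exists_weights_concavity_defect hX hY hM hXs hYs hMs l v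
  rw [Complex.nonneg_iff]
  refine ⟨?_, (hD.im_star_dotProduct_mulVec_self v).symm⟩
  rw [hta]
  refine h _ t a ht fun c hc => ?_
  rw [← hta fun t => (1 - t ^ 2) / (1 - c * t)]
  obtain ⟨s, hs⟩ := exists_kernelForm_eq hc v hM hMs
  have h1 := mul_le_mul_of_nonneg_left (re_cfc_kernel_le_kernelForm hc s v hX hXs) hl0
  have h2 := mul_le_mul_of_nonneg_left (re_cfc_kernel_le_kernelForm hc s v hY hYs)
    (sub_nonneg.mpr hl1)
  rw [kernelForm_convexCombo] at hs
  simp only [sub_mulVec, add_mulVec, smul_mulVec, dotProduct_sub, dotProduct_add,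
      dotProduct_smul, Complex.sub_re, Complex.add_re, Complex.smul_re, smul_eq_mul]
  linarith

lemma operatorConcaveOn_of_holomorphic {F : ℂ → ℂ} {ψ : ℝ → ℝ}
    (hF : DifferentiableOn ℂ F rightHalfPlane) (hre : ∀ u ∈ rightHalfPlane, 0 ≤ (F u).re)
    (hψ : ∀ x : ℝ, 0 < x → (F x).re = (x + x⁻¹) * ψ ((x ^ 2 - 1) / (x ^ 2 + 1))) :
    OperatorConcaveOn ψ (Ioo (-1) 1) :=
  operatorConcaveOn_of_kernel fun _ _ t a ht ha => sum_nonneg_of_kernel hF hre hψ t ht a ha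

end

/-- For an isometry `S`, `α ∈ [1/2, 1)`, and Hermitian directions `H, K` such that
`G, G ± H, Z, Z ± K` are positive definite, the function
`ψ(t) := Tr[((G+tH)^{1/2} Sᴴ (Z+tK)^{(1−α)/α} S (G+tH)^{1/2})^α]`
is operator-concave on `(−1, 1)`. -/
theorem stmt7 {n k : ℕ} (S : Matrix (Fin n) (Fin k) ℂ) (hS : Sᴴ * S = 1)
    (α : ℝ) (hα : α ∈ Set.Ico (1 / 2 : ℝ) 1)
    (G H : Matrix (Fin k) (Fin k) ℂ) (Z K : Matrix (Fin n) (Fin n) ℂ)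
    (hG : G.IsHermitian) (hH : H.IsHermitian) (hZ : Z.IsHermitian) (hK : K.IsHermitian)
    (hGpd : G.PosDef) (hGHp : (G + H).PosDef) (hGHm : (G - H).PosDef)
    (hZpd : Z.PosDef) (hZKp : (Z + K).PosDef) (hZKm : (Z - K).PosDef) :
    OperatorConcaveOn
      (fun t : ℝ =>
        ((mpow (mpow (G + t • H) (1 / 2) * Sᴴ * mpow (Z + t • K) ((1 - α) / α) * S
          * mpow (G + t • H) (1 / 2)) α).trace).re)
      (Set.Ioo (-1 : ℝ) 1) := by
  obtain ⟨F, hF, hre, hψ⟩ := exists_holomorphic_extension S hS hα G H Z K hGHp hGHm hZKp hZKm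
  exact operatorConcaveOn_of_holomorphic hF hre hψ
end
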